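/- arXiv:1912.08906 — 4 statements merged into one kernel-verified Lean document; each statement's English description precedes it below -/
import Mathlib

section
/- Let p be an odd prime and let G be a quasi-powerful p-group. Then the subgroup Ω_1(G), viewed as a group in its own right, is nilpotent of nilpotency class at most 3. -/
/-- The subgroup of `G` generated by all `n`-th powers. -/
def powSubgroup (G : Type*) [Group G] (n : ℕ) : Subgroup G :=
  Subgroup.closure {x : G | ∃ g : G, g ^ n = x}

/-- `Ω_k`-type subgroup: generated by all elements whose `n`-th power is trivial. -/
def omegaSubgroup (G : Type*) [Group G] (n : ℕ) : Subgroup G :=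
  Subgroup.closure {g : G | g ^ n = 1}

/-- A group is powerful (for a prime `p`) if `[G,G] ≤ G^p`. -/
def IsPowerful (p : ℕ) (G : Type*) [Group G] : Prop :=
  commutator G ≤ powSubgroup G p

/-- A group is quasi-powerful (for a prime `p`) if `G/Z(G)` is powerful. -/
def IsQuasiPowerful (p : ℕ) (G : Type*) [Group G] : Prop :=
  IsPowerful p (G ⧸ Subgroup.center G)

/-- The commutator `[x,y] = x⁻¹y⁻¹xy`. -/
def pcomm {G : Type*} [Group G] (a b : G) : G := a⁻¹ * b⁻¹ * a * b


theorem mul_pow_of_commute_pcomm {G : Type*} [Group G] {x c : G}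
    (hx : Commute x (pcomm c x)) (hc : Commute c (pcomm c x)) (n : ℕ) :
    (x * c) ^ n = x ^ n * c ^ n * pcomm c x ^ n.choose 2 := by
  set z := pcomm c x with hz
  have hcx : c * x = x * c * z := by simp only [hz, pcomm]; group
  have hcn : ∀ n : ℕ, c ^ n * x = x * c ^ n * z ^ n := by
    intro n
    induction n with
    | zero => simp
    | succ n ih =>
      calc c ^ (n + 1) * x = c ^ n * (c * x) := by rw [pow_succ, mul_assoc]
        _ = (c ^ n * x) * (c * z) := by rw [hcx]; simp only [mul_assoc]
        _ = x * c ^ n * (z ^ n * c) * z := by rw [ih]; simp only [mul_assoc]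
        _ = x * c ^ (n + 1) * z ^ (n + 1) := by
          rw [← (hc.pow_right n).eq, pow_succ, pow_succ]; simp only [mul_assoc]
  induction n with
  | zero => simp
  | succ n ih =>
    have h2 : (n + 1).choose 2 = n + n.choose 2 := by
      rw [Nat.choose_succ_succ' n 1, Nat.choose_one_right]
    have hzx : Commute (z ^ n.choose 2) (x * c) := ((hx.mul_left hc).pow_right _).symm
    calc (x * c) ^ (n + 1) = x ^ n * c ^ n * (z ^ n.choose 2 * (x * c)) := by
          rw [pow_succ, ih]; simp only [mul_assoc]
      _ = x ^ n * (c ^ n * x) * c * z ^ n.choose 2 := by rw [hzx.eq]; simp only [mul_assoc]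
      _ = x ^ n * x * c ^ n * (z ^ n * c) * z ^ n.choose 2 := by
          rw [hcn]; simp only [mul_assoc]
      _ = x ^ (n + 1) * c ^ (n + 1) * z ^ (n + 1).choose 2 := by
          rw [← (hc.pow_right n).eq, h2, pow_succ, pow_succ, pow_add]; simp only [mul_assoc]

theorem pow_pcomm_of_commute {G : Type*} [Group G] {x c : G}
    (hc : Commute c (pcomm c x)) (n : ℕ) : pcomm (c ^ n) x = pcomm c x ^ n := by
  have h1 : x⁻¹ * c * x = c * pcomm c x := by simp only [pcomm]; group
  have h2 : x⁻¹ * c ^ n * x = (x⁻¹ * c * x) ^ n := by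
    have := conj_pow (i := n) (a := x⁻¹) (b := c)
    simpa using this.symm
  have h3 : pcomm (c ^ n) x = (c ^ n)⁻¹ * (x⁻¹ * c ^ n * x) := by simp only [pcomm]; group
  rw [h3, h2, h1, hc.mul_pow]; group

open scoped commutatorElement in
theorem pcomm_eq_commutatorElement {G : Type*} [Group G] (a b : G) :
    pcomm a b = ⁅a⁻¹, b⁻¹⁆ := by
  simp [pcomm, commutatorElement_def]

theorem commute_iff_pcomm {G : Type*} [Group G] {a b : G} : pcomm a b = 1 ↔ Commute a b := by
  rw [pcomm_eq_commutatorElement, commutatorElement_eq_one_iff_commute, Commute.inv_left_iff, Commute.inv_right_iff]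

/-- `(x c)^p = x^p c^p` when `[c, x]` is central in `⟨x, c⟩` of order dividing the odd number `p`. -/
theorem mul_pow_odd {G : Type*} [Group G] {x c : G} {p : ℕ} (hodd : Odd p)
    (hx : Commute x (pcomm c x)) (hc : Commute c (pcomm c x)) (hz : pcomm c x ^ p = 1) :
    (x * c) ^ p = x ^ p * c ^ p := by
  rw [mul_pow_of_commute_pcomm hx hc]
  obtain ⟨k, rfl⟩ := hodd
  have : (2 * k + 1).choose 2 = (2 * k + 1) * k := by
    rw [Nat.choose_two_right, Nat.add_sub_cancel]
    rw [show (2 * k + 1) * (2 * k) = ((2 * k + 1) * k) * 2 by ring]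
    simp
  rw [this, pow_mul, hz]; simp

/-- The commutation relation in the filtration `N`: if `w ∈ N i` and `d ∈ N j` have orders dividing
`p ^ r` and `p ^ s` with `r + s ≤ i + j + 1`, then `w` and `d` commute. -/
theorem commute_of_filtration {G : Type*} [Group G] {p : ℕ} (hodd : Odd p) (N : ℕ → Subgroup G)
    (hanti : Antitone N) {K : ℕ} (hK : N K = ⊥)
    (hcomm : ∀ i j x y, x ∈ N i → y ∈ N j → pcomm x y ∈ N (i + j + 1))
    (hpow : ∀ i x, x ∈ N i → x ^ p ∈ N (i + 1))
    (hroot : ∀ i x, x ∈ N (i + 1) → ∃ y ∈ N i, y ^ p = x)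
    (hord : ∀ (k : ℕ) (x g : G), x ^ p ^ k = 1 → pcomm x g ^ p ^ k = 1) :
    ∀ n i j r s : ℕ, K ≤ i + j + n → r + s ≤ i + j + 1 → ∀ w ∈ N i, ∀ d ∈ N j,
      w ^ p ^ r = 1 → d ^ p ^ s = 1 → Commute w d := by
  have hmk : ∀ {k} {x : G}, x ^ p ^ (k + 1) = 1 → (x ^ p) ^ p ^ k = 1 := by
    intro k x h; rw [← pow_mul, ← pow_succ']; exact h
  intro n
  induction n with
  | zero =>
    intro i j r s hij _ w hw d hd _ _
    have := hanti (by omega : K ≤ i + j + 1) (hcomm i j w d hw hd)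
    rw [hK, Subgroup.mem_bot] at this
    exact commute_iff_pcomm.1 this
  | succ n IH =>
    have core : ∀ r i j s : ℕ, K ≤ i + j + (n + 1) → r + s ≤ i + j + 1 → r ≤ j →
        ∀ w ∈ N i, ∀ d ∈ N j, w ^ p ^ r = 1 → d ^ p ^ s = 1 → Commute w d := by
      intro r
      induction r with
      | zero =>
        intro i j s _ _ _ w _ d _ hw1 _
        have : w = 1 := by simpa using hw1
        rw [this]; exact Commute.one_left d
      | succ r ihr =>
        intro i j s hij hrs hrj w hw d hd hw1 hd1
        obtain ⟨j, rfl⟩ : ∃ j', j = j' + 1 := ⟨j - 1, by omega⟩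
        obtain ⟨a, ha, rfl⟩ := hroot j d hd
        have ha1 : a ^ p ^ (s + 1) = 1 := by rw [pow_succ', pow_mul]; exact hd1
        have hwpa : Commute (w ^ p) a := ihr (i + 1) j (s + 1) (by omega) (by omega) (by omega)
          _ (hpow i w hw) a ha (hmk hw1) ha1
        set c := pcomm w a with hc
        have hcN : c ∈ N (i + j + 1) := hcomm _ _ _ _ hw ha
        have hcr : c ^ p ^ (r + 1) = 1 := hord _ _ _ hw1
        have hcs : c ^ p ^ (s + 1) = 1 := by
          have : c = (pcomm a w)⁻¹ := by simp only [hc, pcomm]; group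
          rw [this, inv_pow, hord _ _ _ ha1, inv_one]
        have hwa : a⁻¹ * w * a = w * c := by simp only [hc, pcomm]; group
        have haw : w⁻¹ * a * w = a * c⁻¹ := by simp only [hc, pcomm]; group
        have hzN : pcomm c w ∈ N (i + j + 1 + i + 1) := hcomm _ _ _ _ hcN hw
        have hzs : pcomm c w ^ p ^ (s + 1) = 1 := hord _ _ _ hcs
        have hwz : Commute w (pcomm c w) :=
          IH i _ (r + 1) (s + 1) (by omega) (by omega) w hw _ hzN hw1 hzs
        have hcz : Commute c (pcomm c w) :=
          IH _ _ (r + 1) (s + 1) (by omega) (by omega) c hcN _ hzN hcr hzs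
        have hwcp : Commute w (c ^ p) :=
          IH _ _ (r + 1) s (by omega) (by omega) w hw _ (hpow _ _ hcN) hw1 (hmk hcs)
        have hzp : pcomm c w ^ p = 1 := by
          rw [← pow_pcomm_of_commute hcz]; exact commute_iff_pcomm.2 hwcp.symm
        have hcp : c ^ p = 1 := by
          have h1 := mul_pow_odd hodd hwz hcz hzp
          have h2 : (a⁻¹ * w * a) ^ p = w ^ p := by
            have := conj_pow (i := p) (a := a⁻¹) (b := w)
            rw [inv_inv] at this
            rw [this, mul_assoc, hwpa.eq]; group
          rw [hwa, h1] at h2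
          simpa using h2
        have hep : c⁻¹ ^ p = 1 := by rw [inv_pow, hcp, inv_one]
        have heN : c⁻¹ ∈ N (i + j + 1) := inv_mem hcN
        have hyN : pcomm c⁻¹ a ∈ N (i + j + 1 + j + 1) := hcomm _ _ _ _ heN ha
        have he1 : c⁻¹ ^ p ^ 1 = 1 := by rwa [pow_one]
        have hy1 : pcomm c⁻¹ a ^ p ^ 1 = 1 := hord _ _ _ he1
        have hey : Commute c⁻¹ (pcomm c⁻¹ a) :=
          IH _ _ 1 1 (by omega) (by omega) _ heN _ hyN he1 hy1
        have hay : Commute a (pcomm c⁻¹ a) :=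
          IH _ _ (s + 1) 1 (by omega) (by omega) a ha _ hyN ha1 hy1
        have h1 := mul_pow_odd hodd hay hey (by rwa [pow_one] at hy1)
        rw [← haw, hep, mul_one] at h1
        have h2 : w⁻¹ * a ^ p * w = a ^ p := by
          have := conj_pow (i := p) (a := w⁻¹) (b := a)
          rw [inv_inv] at this
          rw [← this, h1]
        have h3 : w * (w⁻¹ * a ^ p * w) = w * a ^ p := by rw [h2]
        show w * a ^ p = a ^ p * w
        rw [← h3]; group
    intro i j r s hij hrs w hw d hd hw1 hd1
    by_cases h : r ≤ j
    · exact core r i j s hij hrs h w hw d hd hw1 hd1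
    · exact (core s j i r (by omega) (by omega) (by omega) d hd w hw hd1 hw1).symm

theorem map_pcomm {G H : Type*} [Group G] [Group H] (f : G →* H) (a b : G) :
    f (pcomm a b) = pcomm (f a) (f b) := by
  simp [pcomm]

theorem pcomm_mem_iff {G : Type*} [Group G] (N : Subgroup G) [N.Normal] {a b : G} :
    pcomm a b ∈ N ↔ Commute (QuotientGroup.mk' N a) (QuotientGroup.mk' N b) := by
  rw [← commute_iff_pcomm, ← map_pcomm]
  exact (QuotientGroup.eq_one_iff _).symm

theorem pcomm_mem_commutator {G : Type*} [Group G] {H K : Subgroup G} {a b : G}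
    (ha : a ∈ H) (hb : b ∈ K) : pcomm a b ∈ (⁅H, K⁆ : Subgroup G) := by
  rw [pcomm_eq_commutatorElement]
  exact Subgroup.commutator_mem_commutator (inv_mem ha) (inv_mem hb)

theorem commutator_le_of_pcomm_mem {G : Type*} [Group G] {H K L : Subgroup G}
    (h : ∀ a ∈ H, ∀ b ∈ K, pcomm a b ∈ L) : ⁅H, K⁆ ≤ L := by
  rw [Subgroup.commutator_le]
  intro a ha b hb
  have := h a⁻¹ (inv_mem ha) b⁻¹ (inv_mem hb)
  rwa [pcomm_eq_commutatorElement, inv_inv, inv_inv] at this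

theorem pcomm_mem_of_mem_closure {G : Type*} [Group G] (N : Subgroup G) [N.Normal] {S : Set G}
    {g : G} (h : ∀ x ∈ S, pcomm x g ∈ N) {x : G} (hx : x ∈ Subgroup.closure S) :
    pcomm x g ∈ N := by
  have : Subgroup.closure S ≤
      (Subgroup.centralizer {QuotientGroup.mk' N g}).comap (QuotientGroup.mk' N) := by
    rw [Subgroup.closure_le]
    intro x hx
    exact Subgroup.mem_centralizer_singleton_iff.2 ((pcomm_mem_iff N).1 (h x hx))
  exact (pcomm_mem_iff N).2 (Subgroup.mem_centralizer_singleton_iff.1 (this hx))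

theorem pcomm_pow_eq {G : Type*} [Group G] (x g : G) (n : ℕ) :
    pcomm (x ^ n) g = (x ^ n)⁻¹ * (x * pcomm x g) ^ n := by
  have h := conj_pow (i := n) (a := g⁻¹) (b := x)
  rw [inv_inv] at h
  have h1 : x * pcomm x g = g⁻¹ * x * g := by simp only [pcomm]; group
  rw [h1, h]; simp only [pcomm]; group

theorem mul_pow_congr_mod {G : Type*} [Group G] (N : Subgroup G) [N.Normal] {p : ℕ} (hodd : Odd p)
    {x c : G} (h : ∀ g, pcomm (pcomm c x) g ∈ N) (hz : pcomm c x ^ p ∈ N) :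
    (x ^ p * c ^ p)⁻¹ * (x * c) ^ p ∈ N := by
  rw [← QuotientGroup.eq_one_iff, ← QuotientGroup.mk'_apply]
  set f := QuotientGroup.mk' N with hf
  have h1 := fun g => ((pcomm_mem_iff N).1 (h g)).symm
  have h2 : f (pcomm c x ^ p) = 1 := (QuotientGroup.eq_one_iff _).2 hz
  simp only [map_pcomm, map_pow, map_mul, map_inv, ← hf] at h1 h2 ⊢
  rw [mul_pow_odd hodd (h1 x) (h1 c) h2, inv_mul_cancel]

/-- The subgroup generated by the `p`-th powers of elements of `N`. -/
def Subgroup.powers (p : ℕ) {G : Type*} [Group G] (N : Subgroup G) : Subgroup G :=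
  Subgroup.closure {x | ∃ g ∈ N, g ^ p = x}

theorem Subgroup.pow_mem_powers {p : ℕ} {G : Type*} [Group G] {N : Subgroup G} {x : G}
    (hx : x ∈ N) : x ^ p ∈ N.powers p :=
  Subgroup.subset_closure ⟨x, hx, rfl⟩

theorem Subgroup.powers_le {p : ℕ} {G : Type*} [Group G] (N : Subgroup G) : N.powers p ≤ N := by
  refine (Subgroup.closure_le _).2 ?_
  rintro _ ⟨g, hg, rfl⟩
  exact pow_mem hg p

instance Subgroup.powers_normal {p : ℕ} {G : Type*} [Group G] (N : Subgroup G) [hN : N.Normal] :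
    (N.powers p).Normal := by
  refine ⟨fun n hn g => ?_⟩
  induction hn using Subgroup.closure_induction with
  | mem x hx =>
    obtain ⟨y, hy, rfl⟩ := hx
    rw [← conj_pow]
    exact Subgroup.pow_mem_powers (hN.conj_mem y hy g)
  | one => simp
  | mul x y _ _ hx hy =>
    have : g * (x * y) * g⁻¹ = (g * x * g⁻¹) * (g * y * g⁻¹) := by group
    rw [this]; exact mul_mem hx hy
  | inv x _ hx =>
    have : g * x⁻¹ * g⁻¹ = (g * x * g⁻¹)⁻¹ := by group
    rw [this]; exact inv_mem hx

theorem le_of_le_sup_commutator_top {G : Type*} [Group G] [Group.IsNilpotent G]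
    (L X : Subgroup G) [X.Normal] (h : L ≤ X ⊔ ⁅L, ⊤⁆) : L ≤ X := by
  have hs := QuotientGroup.mk'_surjective X
  set f := QuotientGroup.mk' X with hf
  have h1 : L.map f ≤ ⁅L.map f, ⊤⁆ := by
    have := Subgroup.map_mono (f := f) h
    rwa [Subgroup.map_sup, Subgroup.map_commutator, QuotientGroup.map_mk'_self, bot_sup_eq,
      Subgroup.map_top_of_surjective f hs] at this
  obtain ⟨n, hn⟩ := Subgroup.nilpotent_iff_lowerCentralSeries.1
    (inferInstance : Group.IsNilpotent (G ⧸ X))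
  have h2 : ∀ n, L.map f ≤ (⊤ : Subgroup (G ⧸ X)).lowerCentralSeries n := by
    intro n
    induction n with
    | zero => exact le_top
    | succ n ih => exact h1.trans (Subgroup.commutator_mono ih le_rfl)
  have h3 := h2 n
  rw [hn, le_bot_iff, Subgroup.map_eq_bot_iff, hf, QuotientGroup.ker_mk'] at h3
  exact h3

/-- If `[N, G] ≤ N^p` then `[N^p, G] ≤ (N^p)^p`. -/
theorem pcomm_mem_powers_powers {G : Type*} [Group G] [Group.IsNilpotent G] {p : ℕ} (hodd : Odd p)
    (N : Subgroup G) [N.Normal] (h : ∀ x ∈ N, ∀ g, pcomm x g ∈ N.powers p) :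
    ∀ x ∈ N.powers p, ∀ g, pcomm x g ∈ (N.powers p).powers p := by
  set M := N.powers p with hM
  set L : Subgroup G := ⁅M, ⊤⁆ with hL
  set Y := M.powers p ⊔ ⁅L, ⊤⁆ with hY
  have hMY : ∀ c ∈ M, c ^ p ∈ Y := fun c hc => Subgroup.mem_sup_left (Subgroup.pow_mem_powers hc)
  have hLY : ∀ z ∈ L, ∀ g, pcomm z g ∈ Y := fun z hz g =>
    Subgroup.mem_sup_right (pcomm_mem_commutator hz (Subgroup.mem_top g))
  have key : L ≤ Y := by
    refine commutator_le_of_pcomm_mem fun a ha b _ => ?_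
    refine pcomm_mem_of_mem_closure Y ?_ ha
    rintro _ ⟨x, hx, rfl⟩
    rw [pcomm_pow_eq]
    have hc := h x hx b
    have hz : pcomm (pcomm x b) x ∈ L := pcomm_mem_commutator hc (Subgroup.mem_top _)
    have hzp : pcomm (pcomm x b) x ^ p ∈ Y :=
      hMY _ (Subgroup.commutator_le_left M ⊤ hz)
    have h1 := mul_pow_congr_mod Y hodd (hLY _ hz) hzp
    have h2 := mul_mem (hMY _ hc) h1
    convert h2 using 1
    group
  have := le_of_le_sup_commutator_top L (M.powers p) key
  exact fun x hx g => this (pcomm_mem_commutator hx (Subgroup.mem_top g))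

/-- The series `G, G^p, (G^p)^p, …`. -/
def powSeries (p : ℕ) (G : Type*) [Group G] : ℕ → Subgroup G
  | 0 => ⊤
  | n + 1 => (powSeries p G n).powers p

instance powSeries_normal (p : ℕ) (G : Type*) [Group G] (n : ℕ) : (powSeries p G n).Normal := by
  induction n with
  | zero => exact inferInstanceAs (⊤ : Subgroup G).Normal
  | succ n ih => exact inferInstanceAs ((powSeries p G n).powers p).Normal

theorem powSeries_antitone (p : ℕ) (G : Type*) [Group G] : Antitone (powSeries p G) :=
  antitone_nat_of_succ_le fun _ => Subgroup.powers_le _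

theorem powSeries_pow_mem {p : ℕ} {G : Type*} [Group G] {n : ℕ} {x : G}
    (hx : x ∈ powSeries p G n) : x ^ p ∈ powSeries p G (n + 1) :=
  Subgroup.pow_mem_powers hx

theorem powSeries_one (p : ℕ) (G : Type*) [Group G] : powSeries p G 1 = powSubgroup G p := by
  simp [powSeries, Subgroup.powers, powSubgroup]

theorem powSeries_pcomm_mem_succ {p : ℕ} (hodd : Odd p) {G : Type*} [Group G] [Group.IsNilpotent G]
    (hG : IsPowerful p G) (n : ℕ) :
    ∀ x ∈ powSeries p G n, ∀ g, pcomm x g ∈ powSeries p G (n + 1) := by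
  induction n with
  | zero =>
    intro x hx g
    rw [zero_add, powSeries_one]
    exact hG (pcomm_mem_commutator (Subgroup.mem_top x) (Subgroup.mem_top g))
  | succ n ih => exact pcomm_mem_powers_powers hodd _ ih

theorem powSeries_pcomm_mem {p : ℕ} (hodd : Odd p) {G : Type*} [Group G] [Group.IsNilpotent G]
    (hG : IsPowerful p G) (i j : ℕ) (x y : G) (hx : x ∈ powSeries p G i)
    (hy : y ∈ powSeries p G j) : pcomm x y ∈ powSeries p G (i + j + 1) := by
  have hinv : ∀ a b : G, pcomm a b = (pcomm b a)⁻¹ := fun a b => by simp only [pcomm]; group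
  induction j generalizing x y with
  | zero => exact powSeries_pcomm_mem_succ hodd hG i x hx y
  | succ j ih =>
    rw [hinv]
    refine inv_mem (pcomm_mem_of_mem_closure _ ?_ hy)
    rintro _ ⟨v, hv, rfl⟩
    have hc : pcomm v x ∈ powSeries p G (i + j + 1) := by
      rw [hinv]; exact inv_mem (ih x v hx hv)
    rw [pcomm_pow_eq]
    have hz : pcomm (pcomm v x) v ∈ powSeries p G (i + j + 1 + 1) :=
      powSeries_pcomm_mem_succ hodd hG _ _ hc v
    have h1 := mul_pow_congr_mod (powSeries p G (i + j + 1 + 1)) hodd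
      (fun g => powSeries_antitone p G (Nat.le_succ _) (powSeries_pcomm_mem_succ hodd hG _ _ hz g))
      (pow_mem hz p)
    have h2 := mul_mem (powSeries_pow_mem hc) h1
    have e : i + (j + 1) + 1 = i + j + 1 + 1 := by omega
    rw [e]
    convert h2 using 1
    group

theorem powSeries_mul_pow {p : ℕ} (hodd : Odd p) {G : Type*} [Group G] [Group.IsNilpotent G]
    (hG : IsPowerful p G) (m : ℕ) (x y : G) (hy : y ∈ powSeries p G m) :
    (x ^ p * y ^ p)⁻¹ * (x * y) ^ p ∈ powSeries p G (m + 2) := by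
  have hz := powSeries_pcomm_mem_succ hodd hG _ _ hy x
  exact mul_pow_congr_mod _ hodd (powSeries_pcomm_mem_succ hodd hG _ _ hz) (powSeries_pow_mem hz)

theorem powSeries_exists_pow_congr {p : ℕ} (hodd : Odd p) {G : Type*} [Group G]
    [Group.IsNilpotent G] (hG : IsPowerful p G) (m : ℕ) {n : G} (hn : n ∈ powSeries p G (m + 1)) :
    ∃ y ∈ powSeries p G m, (y ^ p)⁻¹ * n ∈ powSeries p G (m + 2) := by
  induction hn using Subgroup.closure_induction with
  | mem x hx =>
    obtain ⟨y, hy, rfl⟩ := hx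
    exact ⟨y, hy, by simp⟩
  | one => exact ⟨1, one_mem _, by simp⟩
  | mul a b _ _ ha hb =>
    obtain ⟨x, hx, hxa⟩ := ha
    obtain ⟨y, hy, hyb⟩ := hb
    refine ⟨x * y, mul_mem hx hy, ?_⟩
    have h1 := powSeries_mul_pow hodd hG m x y hy
    have h2 := (powSeries_normal p G (m + 2)).conj_mem _ hxa (y ^ p)⁻¹
    have h3 := mul_mem (inv_mem h1) (mul_mem h2 hyb)
    convert h3 using 1
    group
  | inv a _ ha =>
    obtain ⟨x, hx, hxa⟩ := ha
    refine ⟨x⁻¹, inv_mem hx, ?_⟩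
    have h2 := (powSeries_normal p G (m + 2)).conj_mem _ (inv_mem hxa) (x ^ p)
    convert h2 using 1
    rw [inv_pow]
    group

theorem subsingleton_of_powSubgroup_eq_top {p : ℕ} [Fact p.Prime] {H : Type*} [Group H] [Finite H]
    (hH : IsPGroup p H) (h : powSubgroup H p = ⊤) : Subsingleton H := by
  by_contra hs
  rw [not_subsingleton_iff_nontrivial] at hs
  have hnil : Group.IsNilpotent H := hH.isNilpotent
  have hlt := Group.IsSolvable.commutator_lt_top_of_nontrivial H
  apply hlt.ne
  let f : H →* Abelianization H := Abelianization.of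
  have hfs : Function.Surjective f := QuotientGroup.mk'_surjective _
  let F : Abelianization H →* Abelianization H := powMonoidHom p
  have hsurj : Function.Surjective F := by
    have h1 : powSubgroup H p ≤ F.range.comap f := by
      refine (Subgroup.closure_le _).2 ?_
      rintro _ ⟨g, rfl⟩
      exact ⟨f g, (map_pow f g p).symm⟩
    intro a
    obtain ⟨g, rfl⟩ := hfs a
    exact h1 (h ▸ Subgroup.mem_top g)
  have hfin : Finite (Abelianization H) := Finite.of_surjective _ hfs
  have hinj : Function.Injective F := Finite.injective_iff_surjective.2 hsurj
  have hpow : ∀ k (a : Abelianization H), a ^ p ^ k = 1 → a = 1 := by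
    intro k
    induction k with
    | zero => intro a ha; simpa using ha
    | succ k ih =>
      intro a ha
      apply ih
      apply hinj
      rw [map_one]
      change (a ^ p ^ k) ^ p = 1
      rw [← pow_mul, ← pow_succ, ha]
  rw [← Abelianization.ker_of, eq_top_iff]
  intro g _
  obtain ⟨k, hk⟩ := hH g
  exact hpow k _ (by rw [← map_pow, hk, map_one])

theorem Subgroup.eq_bot_of_powers_eq {p : ℕ} [Fact p.Prime] {G : Type*} [Group G] [Finite G]
    (hG : IsPGroup p G) (N : Subgroup G) (h : N.powers p = N) : N = ⊥ := by
  have : powSubgroup N p = ⊤ := by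
    apply Subgroup.map_injective N.subtype_injective
    rw [← MonoidHom.range_eq_map, Subgroup.range_subtype, powSubgroup, MonoidHom.map_closure]
    refine Eq.trans ?_ h
    rw [Subgroup.powers]
    congr 1
    ext x
    constructor
    · rintro ⟨_, ⟨g, rfl⟩, rfl⟩
      exact ⟨g, g.2, by simp⟩
    · rintro ⟨g, hg, rfl⟩
      exact ⟨⟨g, hg⟩ ^ p, ⟨_, rfl⟩, by simp⟩
  have := subsingleton_of_powSubgroup_eq_top (hG.to_subgroup N) this
  exact N.eq_bot_of_subsingleton

theorem exists_powSeries_eq_bot {p : ℕ} [Fact p.Prime] {G : Type*} [Group G] [Finite G]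
    (hG : IsPGroup p G) : ∃ K, powSeries p G K = ⊥ := by
  by_contra! hne
  have h : ∀ n, Nat.card (powSeries p G n) + n ≤ Nat.card G := by
    intro n
    induction n with
    | zero => exact Subgroup.card_le_card_group _
    | succ n ih =>
      have hlt : Nat.card (powSeries p G (n + 1)) < Nat.card (powSeries p G n) := by
        by_contra! hge
        exact hne n (Subgroup.eq_bot_of_powers_eq hG _
          (Subgroup.eq_of_le_of_card_ge (powSeries_antitone p G (Nat.le_succ n)) hge))
      omega
  have h1 := h (Nat.card G)
  have h2 : 0 < Nat.card (powSeries p G (Nat.card G)) := Nat.card_pos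
  omega

theorem powSeries_exists_root {p : ℕ} [Fact p.Prime] (hodd : Odd p) {G : Type*} [Group G] [Finite G]
    (hG : IsPGroup p G) (hP : IsPowerful p G) (i : ℕ) (g : G) (hg : g ∈ powSeries p G (i + 1)) :
    ∃ x ∈ powSeries p G i, x ^ p = g := by
  have hnil : Group.IsNilpotent G := hG.isNilpotent
  have happrox : ∀ m, ∃ x ∈ powSeries p G i, (x ^ p)⁻¹ * g ∈ powSeries p G (i + m + 1) := by
    intro m
    induction m with
    | zero => exact ⟨1, one_mem _, by simpa using hg⟩
    | succ m ih =>
      obtain ⟨x, hx, hxg⟩ := ih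
      obtain ⟨y, hy, hyn⟩ := powSeries_exists_pow_congr hodd hP _ hxg
      refine ⟨x * y, mul_mem hx (powSeries_antitone p G (by omega) hy), ?_⟩
      have h1 := powSeries_mul_pow hodd hP _ x y hy
      have h3 := mul_mem (inv_mem h1) hyn
      convert h3 using 1
      group
  obtain ⟨K, hK⟩ := exists_powSeries_eq_bot hG
  obtain ⟨x, hx, hxg⟩ := happrox K
  have := powSeries_antitone p G (by omega : K ≤ i + K + 1) hxg
  rw [hK, Subgroup.mem_bot, inv_mul_eq_one] at this
  exact ⟨x, hx, this⟩

theorem IsPowerful.map {p : ℕ} {G H : Type*} [Group G] [Group H] (hG : IsPowerful p G)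
    {f : G →* H} (hf : Function.Surjective f) : IsPowerful p H := by
  have h1 : commutator H = (commutator G).map f := by
    rw [commutator_def, commutator_def, Subgroup.map_commutator,
      Subgroup.map_top_of_surjective f hf]
  rw [IsPowerful, h1]
  refine (Subgroup.map_mono hG).trans ?_
  rw [Subgroup.map_le_iff_le_comap]
  refine (Subgroup.closure_le _).2 ?_
  rintro _ ⟨g, rfl⟩
  exact Subgroup.subset_closure ⟨f g, (map_pow f g p).symm⟩

theorem isPowerful_zpowers_sup {p : ℕ} (hodd : Odd p) {G : Type*} [Group G] [Group.IsNilpotent G]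
    (hG : IsPowerful p G) (x : G) :
    IsPowerful p (Subgroup.zpowers x ⊔ powSeries p G 1 : Subgroup G) := by
  set H := Subgroup.zpowers x ⊔ powSeries p G 1 with hH
  have h2 : ∀ a ∈ H, ∀ b ∈ H, pcomm a b ∈ powSeries p G 2 := by
    intro a ha b hb
    obtain ⟨_, ⟨k, rfl⟩, n, hn, rfl⟩ := Subgroup.mem_sup_of_normal_right.1 ha
    obtain ⟨_, ⟨l, rfl⟩, m, hm, rfl⟩ := Subgroup.mem_sup_of_normal_right.1 hb
    have hcen : ∀ n ∈ powSeries p G 1, ∀ g, Commute (QuotientGroup.mk' (powSeries p G 2) n)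
        (QuotientGroup.mk' (powSeries p G 2) g) := fun n hn g =>
      (pcomm_mem_iff _).1 (powSeries_pcomm_mem_succ hodd hG 1 n hn g)
    rw [pcomm_mem_iff, map_mul]
    refine Commute.mul_left ?_ (hcen n hn _)
    rw [map_mul]
    refine Commute.mul_right ?_ (hcen m hm _).symm
    simp only [map_zpow]
    exact ((Commute.refl _).zpow_left _).zpow_right _
  have h3 : powSeries p G 2 ≤ (powSubgroup H p).map H.subtype := by
    refine (Subgroup.closure_le _).2 ?_
    rintro _ ⟨g, hg, rfl⟩
    refine ⟨⟨g, Subgroup.mem_sup_right hg⟩ ^ p, Subgroup.subset_closure ⟨_, rfl⟩, by simp⟩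
  refine commutator_le_of_pcomm_mem fun a _ b _ => ?_
  obtain ⟨c, hc, hcab⟩ := h3 (h2 a a.2 b b.2)
  have : c = pcomm a b := by
    apply H.subtype_injective
    rw [hcab, map_pcomm]; rfl
  rwa [← this]

theorem zpowers_eq_top_of_sup_eq_top {p : ℕ} [Fact p.Prime] (hodd : Odd p) {G : Type*} [Group G]
    [Finite G] (hG : IsPGroup p G) (hP : IsPowerful p G) {x : G}
    (h : Subgroup.zpowers x ⊔ powSeries p G 1 = ⊤) : Subgroup.zpowers x = ⊤ := by
  have hnil : Group.IsNilpotent G := hG.isNilpotent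
  have hstep : ∀ i, powSeries p G i ≤ Subgroup.zpowers x ⊔ powSeries p G (i + 1) := by
    intro i
    induction i with
    | zero => rw [zero_add, h]; exact le_top
    | succ i ih =>
      intro g hg
      obtain ⟨y, hy, rfl⟩ := powSeries_exists_root hodd hG hP i g hg
      obtain ⟨_, ⟨k, rfl⟩, n, hn, rfl⟩ := Subgroup.mem_sup_of_normal_right.1 (ih hy)
      have h1 := powSeries_mul_pow hodd hP _ (x ^ k) n hn
      have h2 := mul_mem (powSeries_pow_mem hn)
        (powSeries_antitone p G (by omega : i + 1 + 1 ≤ i + 1 + 2) h1)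
      have h3 : (x ^ k) ^ p ∈ Subgroup.zpowers x := pow_mem (Subgroup.zpow_mem_zpowers x k) p
      convert Subgroup.mul_mem_sup h3 h2 using 1
      simp only [mul_inv_rev]
      rw [← mul_assoc, ← mul_assoc, ← mul_assoc]
      simp
  have hall : ∀ i, (⊤ : Subgroup G) ≤ Subgroup.zpowers x ⊔ powSeries p G i := by
    intro i
    induction i with
    | zero => exact le_sup_right
    | succ i ih => exact ih.trans (sup_le le_sup_left (hstep i))
  obtain ⟨K, hK⟩ := exists_powSeries_eq_bot hG
  have := hall K
  rwa [hK, sup_bot_eq, top_le_iff] at this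

/-- Elements of order dividing `p` commute with the elements of order dividing `p` in `G^p`, provided
commutators behave well with respect to orders. -/
theorem commute_of_pow_eq_one {p : ℕ} [Fact p.Prime] (hodd : Odd p) {G : Type*} [Group G] [Finite G]
    (hG : IsPGroup p G) (hP : IsPowerful p G)
    (hord : ∀ (k : ℕ) (x g : G), x ^ p ^ k = 1 → pcomm x g ^ p ^ k = 1)
    {w d : G} (hw : w ^ p = 1) (hd : d ∈ powSeries p G 1) (hdp : d ^ p = 1) : Commute w d := by
  have hnil : Group.IsNilpotent G := hG.isNilpotent
  obtain ⟨K, hK⟩ := exists_powSeries_eq_bot hG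
  exact commute_of_filtration hodd (powSeries p G) (powSeries_antitone p G) hK
    (powSeries_pcomm_mem hodd hP) (fun _ _ => powSeries_pow_mem)
    (powSeries_exists_root hodd hG hP) hord K 0 1 1 1 (by omega) (by omega) w
    (Subgroup.mem_top w) d hd (by simpa using hw) (by simpa using hdp)

theorem pcomm_eq_inv_mul_conj {G : Type*} [Group G] (x g : G) :
    pcomm x g = x⁻¹ * (g⁻¹ * x * g) := by
  simp only [pcomm]; group

theorem conj_inv_pow_eq_one {G : Type*} [Group G] {x : G} {n : ℕ} (g : G) (hx : x ^ n = 1) :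
    (g⁻¹ * x * g) ^ n = 1 := by
  have := conj_pow (i := n) (a := g⁻¹) (b := x)
  rw [inv_inv] at this
  rw [this, hx]; simp

/-- In a powerful `p`-group with `p` odd, the elements of order dividing `p ^ k` are closed under
multiplication. -/
theorem IsPowerful.mul_pow_eq_one {p : ℕ} [Fact p.Prime] (hodd : Odd p) (n : ℕ) :
    ∀ (G : Type*) [Group G] [Finite G], Nat.card G = n → IsPGroup p G → IsPowerful p G →
      ∀ (k : ℕ) (x y : G), x ^ p ^ k = 1 → y ^ p ^ k = 1 → (x * y) ^ p ^ k = 1 := by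
  induction n using Nat.strong_induction_on with
  | _ n IH =>
  intro G _ _ hn hG hP
  have hnil : Group.IsNilpotent G := hG.isNilpotent
  have hord : ∀ (k : ℕ) (x g : G), x ^ p ^ k = 1 → pcomm x g ^ p ^ k = 1 := by
    intro k x g hx
    by_cases hH : Subgroup.zpowers x ⊔ powSeries p G 1 = ⊤
    · have hz := zpowers_eq_top_of_sup_eq_top hodd hG hP hH
      obtain ⟨l, rfl⟩ : g ∈ Subgroup.zpowers x := hz ▸ Subgroup.mem_top g
      rw [commute_iff_pcomm.2 ((Commute.refl x).zpow_right l), one_pow]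
    · set H := Subgroup.zpowers x ⊔ powSeries p G 1 with hHdef
      have hcard : Nat.card H < n := by
        by_contra! hge
        exact hH (Subgroup.eq_top_of_le_card _ (hn ▸ hge))
      have hxH : x ∈ H := Subgroup.mem_sup_left (Subgroup.mem_zpowers x)
      have hcH : pcomm x g ∈ H := Subgroup.mem_sup_right
        (powSeries_pcomm_mem_succ hodd hP 0 x (Subgroup.mem_top x) g)
      have hyH : g⁻¹ * x * g ∈ H := by
        have := mul_mem hxH hcH
        rwa [pcomm_eq_inv_mul_conj, mul_inv_cancel_left] at this
      have h1 := IH _ hcard H rfl (hG.to_subgroup H) (isPowerful_zpowers_sup hodd hP x) k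
        (⟨x, hxH⟩ : H)⁻¹ ⟨_, hyH⟩ (by ext; simp [hx]) (by
          ext; simpa using conj_inv_pow_eq_one g hx)
      have h2 := congrArg H.subtype h1
      rw [pcomm_eq_inv_mul_conj]
      simpa using h2
  have hone : ∀ x y : G, x ^ p = 1 → y ^ p = 1 → (x * y) ^ p = 1 := by
    intro x y hx hy
    have hc : pcomm y x ∈ powSeries p G 1 :=
      powSeries_pcomm_mem_succ hodd hP 0 y (Subgroup.mem_top y) x
    have hcp : pcomm y x ^ p = 1 := by simpa using hord 1 y x (by simpa using hy)
    rw [mul_pow_odd hodd (commute_of_pow_eq_one hodd hG hP hord hx hc hcp)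
      (commute_of_pow_eq_one hodd hG hP hord hy hc hcp) hcp, hx, hy, one_mul]
  let W : Subgroup G :=
    { carrier := {g | g ^ p = 1}
      mul_mem' := fun {a b} ha hb => hone a b ha hb
      one_mem' := one_pow p
      inv_mem' := fun {a} (ha : a ^ p = 1) => by
        show a⁻¹ ^ p = 1
        rw [inv_pow, ha, inv_one] }
  have hWmem : ∀ g, g ∈ W ↔ g ^ p = 1 := fun g => Iff.rfl
  have hWn : W.Normal := ⟨fun a (ha : a ^ p = 1) g => by
    show (g * a * g⁻¹) ^ p = 1
    rw [conj_pow, ha]; simp⟩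
  have hlast : ∀ k (x : G), x ^ p ^ (k + 1) = 1 ↔ x ^ p ^ k ∈ W := by
    intro k x
    rw [hWmem, ← pow_mul, ← pow_succ]
  intro k
  induction k with
  | zero =>
    intro x y hx hy
    simp only [pow_zero, pow_one] at hx hy ⊢
    rw [hx, hy, one_mul]
  | succ k ihk =>
    intro x y hx hy
    rw [hlast] at hx hy ⊢
    by_cases hW : W = ⊥
    · rw [hW, Subgroup.mem_bot] at hx hy ⊢
      exact ihk x y hx hy
    · have hcard : Nat.card (G ⧸ W) < n := by
        have h1 := W.card_eq_card_quotient_mul_card_subgroup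
        have h2 := (Subgroup.one_lt_card_iff_ne_bot W).2 hW
        have h3 : 0 < Nat.card (G ⧸ W) := Nat.card_pos
        rw [← hn, h1]
        exact lt_mul_of_one_lt_right h3 h2
      have h := IH _ hcard (G ⧸ W) rfl (hG.to_quotient W)
        (hP.map (QuotientGroup.mk'_surjective W)) k (x : G ⧸ W) (y : G ⧸ W)
        ((QuotientGroup.eq_one_iff _).2 hx) ((QuotientGroup.eq_one_iff _).2 hy)
      exact (QuotientGroup.eq_one_iff _).1 h

/-- In a powerful `p`-group with `p` odd, `[x, y, z] = 1` for all `x, y, z` of order dividing `p`. -/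
theorem IsPowerful.commute_pcomm {p : ℕ} [Fact p.Prime] (hodd : Odd p) {G : Type*} [Group G]
    [Finite G] (hG : IsPGroup p G) (hP : IsPowerful p G) {x z : G} (y : G) (hx : x ^ p = 1)
    (hz : z ^ p = 1) : Commute (pcomm x y) z := by
  have hnil : Group.IsNilpotent G := hG.isNilpotent
  have hord : ∀ (k : ℕ) (x g : G), x ^ p ^ k = 1 → pcomm x g ^ p ^ k = 1 := by
    intro k x g hx
    rw [pcomm_eq_inv_mul_conj]
    exact IsPowerful.mul_pow_eq_one hodd _ G rfl hG hP k _ _ (by rw [inv_pow, hx, inv_one])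
      (conj_inv_pow_eq_one g hx)
  refine (commute_of_pow_eq_one hodd hG hP hord hz ?_ ?_).symm
  · exact powSeries_pcomm_mem_succ hodd hP 0 x (Subgroup.mem_top x) y
  · simpa using hord 1 x y (by simpa using hx)

theorem omega_one_class_le_three (p : ℕ) (hp : p.Prime) (hodd : Odd p)
    (G : Type*) [Group G] [Finite G]
    (hG : IsPGroup p G) (hQP : IsQuasiPowerful p G) :
    lowerCentralSeries (omegaSubgroup G p) 3 = ⊥ := by
  have : Fact p.Prime := ⟨hp⟩
  set Z := Subgroup.center G with hZ
  set f := QuotientGroup.mk' Z with hf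
  have hQ : IsPGroup p (G ⧸ Z) := hG.to_quotient Z
  have hΩ : ∀ x ∈ omegaSubgroup G p, f x ^ p = 1 := by
    intro x hx
    induction hx using Subgroup.closure_induction with
    | mem x hx => rw [← map_pow, show x ^ p = 1 from hx, map_one]
    | one => simp
    | mul x y _ _ hx hy =>
      have := IsPowerful.mul_pow_eq_one hodd _ (G ⧸ Z) rfl hQ hQP 1 (f x) (f y)
        (by simpa using hx) (by simpa using hy)
      simpa using this
    | inv x _ hx => rw [map_inv, inv_pow, hx, inv_one]
  have h2 : ⁅⁅omegaSubgroup G p, omegaSubgroup G p⁆, omegaSubgroup G p⁆ ≤ Z := by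
    refine commutator_le_of_pcomm_mem fun a ha z hz => ?_
    have hle : ⁅omegaSubgroup G p, omegaSubgroup G p⁆ ≤
        (Subgroup.centralizer {f z}).comap f := by
      refine commutator_le_of_pcomm_mem fun x hx y _ => ?_
      rw [Subgroup.mem_comap, Subgroup.mem_centralizer_singleton_iff, map_pcomm]
      exact IsPowerful.commute_pcomm hodd hQ hQP (f y) (hΩ x hx) (hΩ z hz)
    exact (pcomm_mem_iff Z).2 (Subgroup.mem_centralizer_singleton_iff.1 (hle ha))
  show ⁅⁅⁅omegaSubgroup G p, omegaSubgroup G p⁆, omegaSubgroup G p⁆, omegaSubgroup G p⁆ = ⊥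
  rw [eq_bot_iff, ← Subgroup.commutator_center_left (H := omegaSubgroup G p)]
  exact Subgroup.commutator_mono h2 le_rfl
end

section
/- Let p be a prime with p > 3 and let G be a quasi-powerful p-group. Then Ω_1(G) has exponent dividing p; that is, every element x ∈ Ω_1(G) satisfies x^p = 1. -/
open scoped commutatorElement

/-- The collection formula in class three. -/
theorem mul_pow_eq_of_central_triple_commutators {G : Type*} [Group G] {x y u v w : G}
    (hu : y * x = x * y * u) (hv : u * x = x * u * v) (hw : u * y = y * u * w)
    (hvx : Commute v x) (hvy : Commute v y) (hwx : Commute w x) (hwy : Commute w y) (n : ℕ) :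
    (x * y) ^ n = x ^ n * y ^ n * u ^ n.choose 2 * v ^ n.choose 3 *
      w ^ (n.choose 2 + 2 * n.choose 3) := by
  have central : ∀ t : G, Commute t x → Commute t y → Commute t u ∧ Commute t v := by
    intro t htx hty
    have hu' : u = (x * y)⁻¹ * (y * x) := by rw [hu]; group
    have htu : Commute t u := by
      rw [hu']
      exact ((htx.mul_right hty).inv_right).mul_right (hty.mul_right htx)
    have hv' : v = (x * u)⁻¹ * (u * x) := by rw [hv]; group
    refine ⟨htu, ?_⟩
    rw [hv']
    exact ((htx.mul_right htu).inv_right).mul_right (htu.mul_right htx)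
  have hvu := (central v hvx hvy).1
  have hwu := (central w hwx hwy).1
  have hwv := (central w hwx hwy).2
  have move : ∀ (t : G) (_ : Commute v t), u * t = t * u * v → ∀ a : ℕ,
      u ^ a * t = t * u ^ a * v ^ a := by
    intro t hvt h a
    induction a with
    | zero => simp
    | succ a ih =>
      calc u ^ (a + 1) * t = u ^ a * (u * t) := by rw [pow_succ]; group
        _ = (u ^ a * t) * u * v := by rw [h]; group
        _ = t * u ^ a * (v ^ a * u) * v := by rw [ih]; group
        _ = t * u ^ a * (u * v ^ a) * v := by rw [(hvu.pow_left a).eq]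
        _ = t * u ^ (a + 1) * v ^ (a + 1) := by simp only [pow_succ, mul_assoc]
  have movey : ∀ a : ℕ, u ^ a * y = y * u ^ a * w ^ a := by
    intro a
    induction a with
    | zero => simp
    | succ a ih =>
      calc u ^ (a + 1) * y = u ^ a * (u * y) := by rw [pow_succ]; group
        _ = (u ^ a * y) * u * w := by rw [hw]; group
        _ = y * u ^ a * (w ^ a * u) * w := by rw [ih]; group
        _ = y * u ^ a * (u * w ^ a) * w := by rw [(hwu.pow_left a).eq]
        _ = y * u ^ (a + 1) * w ^ (a + 1) := by simp only [pow_succ, mul_assoc]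
  have movex := move x hvx hv
  have hyx : ∀ m : ℕ, y ^ m * x = x * y ^ m * u ^ m * w ^ m.choose 2 := by
    intro m
    induction m with
    | zero => simp
    | succ m ih =>
      have hc : (m + 1).choose 2 = m + m.choose 2 := by
        rw [Nat.choose_succ_succ' m 1, Nat.choose_one_right]
      calc y ^ (m + 1) * x = y * (y ^ m * x) := by rw [pow_succ']; group
        _ = (y * x) * y ^ m * u ^ m * w ^ m.choose 2 := by rw [ih]; group
        _ = x * y * (u * y ^ m) * u ^ m * w ^ m.choose 2 := by rw [hu]; group
        _ = x * y * (y ^ m * u * w ^ m) * u ^ m * w ^ m.choose 2 := by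
          congr 3
          clear ih hc
          induction m with
          | zero => simp
          | succ k ihk =>
            calc u * y ^ (k + 1) = (u * y ^ k) * y := by rw [pow_succ]; group
              _ = y ^ k * u * (w ^ k * y) := by rw [ihk]; group
              _ = y ^ k * (u * y) * w ^ k := by rw [(hwy.pow_left k).eq]; group
              _ = y ^ (k + 1) * u * w ^ (k + 1) := by
                rw [hw, pow_succ, pow_succ']; group
        _ = x * (y * y ^ m) * u * (w ^ m * u ^ m) * w ^ m.choose 2 := by group
        _ = x * y ^ (m + 1) * u ^ (m + 1) * w ^ (m + 1).choose 2 := by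
          rw [((hwu.pow_left m).pow_right m).eq, hc, pow_add w, pow_succ' y, pow_succ' u]
          group
  induction n with
  | zero => simp
  | succ n ih =>
    have h2 : (n + 1).choose 2 = n + n.choose 2 := by
      rw [Nat.choose_succ_succ' n 1, Nat.choose_one_right]
    have h3 : (n + 1).choose 3 = n.choose 2 + n.choose 3 := Nat.choose_succ_succ' n 2
    have hya := hyx n
    generalize n.choose 2 = a at *
    generalize n.choose 3 = b at *
    have e : ((n + 1).choose 2 + 2 * (n + 1).choose 3) =
        (n + a) + a + (a + 2 * b) := by rw [h2, h3]; ring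
    rw [e, h2, h3]
    have hw_xy : Commute (w ^ (a + 2 * b)) (x * y) := (hwx.mul_right hwy).pow_left _
    have hv_xy : Commute (v ^ b) (x * y) := (hvx.mul_right hvy).pow_left _
    calc (x * y) ^ (n + 1)
        = x ^ n * y ^ n * u ^ a * v ^ b * (w ^ (a + 2 * b) * (x * y)) := by
          rw [pow_succ, ih]; group
      _ = x ^ n * y ^ n * u ^ a * (v ^ b * (x * y)) * w ^ (a + 2 * b) := by
          rw [hw_xy.eq]; group
      _ = x ^ n * y ^ n * (u ^ a * x) * y * v ^ b * w ^ (a + 2 * b) := by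
          rw [hv_xy.eq]; group
      _ = x ^ n * (y ^ n * x) * u ^ a * (v ^ a * y) * v ^ b * w ^ (a + 2 * b) := by
          rw [movex]; group
      _ = x ^ n * (y ^ n * x) * u ^ a * y * v ^ a * v ^ b * w ^ (a + 2 * b) := by
          rw [(hvy.pow_left a).eq]; group
      _ = x ^ n * (x * y ^ n * u ^ n) * (w ^ a * (u ^ a * y)) * v ^ a * v ^ b *
            w ^ (a + 2 * b) := by
          rw [hya]; group
      _ = (x ^ n * x) * y ^ n * (u ^ n * u ^ a * y) * w ^ a * (v ^ a * v ^ b) *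
            w ^ (a + 2 * b) := by
          rw [((hwu.pow_left a).pow_right a |>.mul_right (hwy.pow_left a)).eq]; group
      _ = x ^ (n + 1) * (y ^ n * y) * u ^ (n + a) * (w ^ (n + a) * w ^ a * v ^ (a + b)) *
            w ^ (a + 2 * b) := by
          rw [← pow_add, ← pow_add, ← pow_succ, movey]; group
      _ = _ := by
          rw [← pow_add w, ((hwv.pow_left _).pow_right _).eq, ← pow_succ, pow_add w (n + a + a)]
          simp only [mul_assoc]

theorem mul_pow_prime_of_central_commutator {p : ℕ} (hp : p.Prime) (hp2 : 2 < p)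
    {G : Type*} [Group G] {x y u : G} (hu : y * x = x * y * u)
    (hux : Commute u x) (huy : Commute u y) (hup : u ^ p = 1) :
    (x * y) ^ p = x ^ p * y ^ p := by
  have h := mul_pow_eq_of_central_triple_commutators (v := 1) (w := 1) hu
    (by rw [hux.eq, mul_one]) (by rw [huy.eq, mul_one]) (Commute.one_left _)
    (Commute.one_left _) (Commute.one_left _) (Commute.one_left _) p
  obtain ⟨k, hk⟩ := hp.dvd_choose_self (k := 2) (by norm_num) hp2
  rw [h, hk, pow_mul, hup]
  simp

/-- If `⁅x, y⁆` has order dividing `p` and generates with `y` a group of class at most two,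
then `x` centralises `y ^ p`. -/
theorem commute_pow_prime {p : ℕ} (hp : p.Prime) (hp2 : 2 < p)
    {G : Type*} [Group G] {x y : G} (hb : ⁅x, y⁆ ^ p = 1)
    (hy : Commute ⁅⁅x, y⁆, y⁆ y) (hc : Commute ⁅⁅x, y⁆, y⁆ ⁅x, y⁆) :
    Commute x (y ^ p) := by
  have hxy : x * y * x⁻¹ = ⁅x, y⁆ * y := by rw [commutatorElement_def]; group
  generalize ⁅x, y⁆ = b at *
  have hby : b * y * b⁻¹ = ⁅b, y⁆ * y := by rw [commutatorElement_def]; group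
  have hyb : y * b * y⁻¹ = ⁅b, y⁆⁻¹ * b := by rw [commutatorElement_def]; group
  generalize ⁅b, y⁆ = u at *
  have hup : u⁻¹ ^ p = 1 := by
    have h : (y * b * y⁻¹) ^ p = 1 := by rw [conj_pow, hb]; group
    rwa [hyb, hc.inv_left.mul_pow, hb, mul_one] at h
  have h : (b * y) ^ p = y ^ p := by
    rw [mul_pow_prime_of_central_commutator hp hp2 (u := u⁻¹) ?_ hc.inv_left hy.inv_left hup, hb,
      one_mul]
    calc y * b = (y * b * y⁻¹) * y := by group
      _ = u⁻¹ * (b * y) := by rw [hyb]; group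
      _ = b * y * u⁻¹ := (hc.inv_left.mul_right hy.inv_left).eq
  have h' : x * y ^ p * x⁻¹ = y ^ p := by rw [← conj_pow, hxy, h]
  exact mul_inv_eq_iff_eq_mul.mp h'

/-- The subgroup generated by the `p`-th powers of the elements of `N`. -/
def powersIn {G : Type*} [Group G] (p : ℕ) (N : Subgroup G) : Subgroup G :=
  Subgroup.closure ((fun x => x ^ p) '' (N : Set G))

theorem pow_mem_powersIn {G : Type*} [Group G] {p : ℕ} {N : Subgroup G} {x : G} (hx : x ∈ N) :
    x ^ p ∈ powersIn p N :=
  Subgroup.subset_closure ⟨x, hx, rfl⟩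

theorem powersIn_le_iff {G : Type*} [Group G] {p : ℕ} {N K : Subgroup G} :
    powersIn p N ≤ K ↔ ∀ x ∈ N, x ^ p ∈ K := by
  rw [powersIn, Subgroup.closure_le]
  exact Set.image_subset_iff

theorem powersIn_le {G : Type*} [Group G] (p : ℕ) (N : Subgroup G) : powersIn p N ≤ N :=
  powersIn_le_iff.mpr fun _ hx => N.pow_mem hx p

instance powersIn_normal {G : Type*} [Group G] (p : ℕ) (N : Subgroup G) [hN : N.Normal] :
    (powersIn p N).Normal := by
  refine ⟨fun n hn g => ?_⟩
  have h : powersIn p N ≤ (powersIn p N).comap (MulAut.conj g).toMonoidHom := by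
    refine powersIn_le_iff.mpr fun x hx => ?_
    simp only [Subgroup.mem_comap, MulEquiv.coe_toMonoidHom, MulAut.conj_apply, ← conj_pow]
    exact pow_mem_powersIn (hN.conj_mem x hx g)
  exact h hn

theorem mem_comap_center_iff {G : Type*} [Group G] {L : Subgroup G} [L.Normal] {g : G} :
    g ∈ (Subgroup.center (G ⧸ L)).comap (QuotientGroup.mk' L) ↔ ∀ h, ⁅g, h⁆ ∈ L := by
  rw [Subgroup.mem_comap, Subgroup.mem_center_iff, QuotientGroup.forall_mk]
  refine forall_congr' fun h => ?_
  rw [← QuotientGroup.eq_one_iff, ← QuotientGroup.mk'_apply, ← QuotientGroup.mk'_apply,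
    map_commutatorElement, commutatorElement_eq_one_iff_mul_comm, eq_comm]

theorem le_of_le_sup_commutator {G : Type*} [Group G] [Group.IsNilpotent G] {K P : Subgroup G}
    [K.Normal] [P.Normal] (h : K ≤ P ⊔ ⁅K, ⊤⁆) : K ≤ P := by
  have hle : ∀ n, K ≤ P ⊔ (⊤ : Subgroup G).lowerCentralSeries n := by
    intro n
    induction n with
    | zero => simp
    | succ n ih =>
      refine h.trans (sup_le le_sup_left (Subgroup.commutator_le.mpr fun a ha g _ => ?_))
      obtain ⟨b, hb, c, hc, rfl⟩ := Subgroup.mem_sup_of_normal_left.mp (ih ha)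
      have e : ⁅b * c, g⁆ = (b * (c * g * c⁻¹) * b⁻¹ * (c * g * c⁻¹)⁻¹) * ⁅c, g⁆ := by
        rw [commutatorElement_def, commutatorElement_def]; group
      rw [e]
      refine Subgroup.mul_mem_sup ?_ (Subgroup.commutator_mem_commutator hc (Subgroup.mem_top g))
      rw [mul_assoc, mul_assoc]
      refine P.mul_mem hb ?_
      rw [← mul_assoc]
      exact (inferInstance : P.Normal).conj_mem _ (P.inv_mem hb) _
  obtain ⟨n, hn⟩ := Subgroup.nilpotent_iff_lowerCentralSeries.mp (inferInstance : Group.IsNilpotent G)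
  simpa [hn] using hle n

theorem commutator_powersIn_le {p : ℕ} (hp : p.Prime) (hp2 : 2 < p) {G : Type*} [Group G]
    [Group.IsNilpotent G] {N M : Subgroup G} [N.Normal] [M.Normal] (hNM : ⁅N, ⊤⁆ ≤ M)
    (hM : ⁅M, ⊤⁆ ≤ ⁅powersIn p N, (⊤ : Subgroup G)⁆) :
    ⁅powersIn p N, (⊤ : Subgroup G)⁆ ≤ powersIn p M := by
  set K : Subgroup G := ⁅powersIn p N, (⊤ : Subgroup G)⁆
  apply le_of_le_sup_commutator
  set L : Subgroup G := powersIn p M ⊔ ⁅K, (⊤ : Subgroup G)⁆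
  have hcen : powersIn p N ≤ (Subgroup.center (G ⧸ L)).comap (QuotientGroup.mk' L) := by
    refine powersIn_le_iff.mpr fun n hn => ?_
    rw [Subgroup.mem_comap, Subgroup.mem_center_iff, QuotientGroup.forall_mk]
    intro g
    have hd : ⁅g, n⁆ ∈ M := by
      rw [← commutatorElement_inv]
      exact M.inv_mem (hNM (Subgroup.commutator_mem_commutator hn (Subgroup.mem_top g)))
    have hu : ∀ h, Commute (QuotientGroup.mk' L ⁅⁅g, n⁆, n⁆) (QuotientGroup.mk' L h) := by
      intro h
      rw [← commutatorElement_eq_one_iff_commute, ← map_commutatorElement, QuotientGroup.mk'_apply,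
        QuotientGroup.eq_one_iff]
      exact le_sup_right (a := powersIn p M) (Subgroup.commutator_mem_commutator
        (hM (Subgroup.commutator_mem_commutator hd (Subgroup.mem_top n))) (Subgroup.mem_top h))
    have := commute_pow_prime hp hp2 (x := QuotientGroup.mk' L g) (y := QuotientGroup.mk' L n)
      ?_ ?_ ?_
    · rw [map_pow]; exact this.eq
    · rw [← map_commutatorElement, ← map_pow, QuotientGroup.mk'_apply, QuotientGroup.eq_one_iff]
      exact le_sup_left (b := ⁅K, (⊤ : Subgroup G)⁆) (pow_mem_powersIn hd)
    · simpa only [map_commutatorElement] using hu n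
    · simpa only [map_commutatorElement] using hu ⁅g, n⁆
  exact Subgroup.commutator_le.mpr fun a ha g _ => mem_comap_center_iff.mp (hcen ha) g

theorem eq_bot_of_le_powersIn {p : ℕ} {G : Type*} [Group G] [Group.IsNilpotent G]
    [Finite G] (hG : IsPGroup p G) (K : Subgroup G) [K.Normal] (hK : K ≤ powersIn p K) : K = ⊥ := by
  rw [eq_bot_iff]
  apply le_of_le_sup_commutator
  rw [bot_sup_eq]
  set π := QuotientGroup.mk' ⁅K, (⊤ : Subgroup G)⁆ with hπ
  have hcomm : ∀ a ∈ K, ∀ b, Commute (π a) (π b) := by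
    intro a ha b
    rw [← commutatorElement_eq_one_iff_commute, ← map_commutatorElement, hπ,
      QuotientGroup.mk'_apply, QuotientGroup.eq_one_iff]
    exact Subgroup.commutator_mem_commutator ha (Subgroup.mem_top b)
  have hroot : ∀ x ∈ K, ∃ a ∈ K, π x = π a ^ p := by
    intro x hx
    replace hx := hK hx
    induction hx using Subgroup.closure_induction with
    | mem x h =>
      obtain ⟨a, ha, rfl⟩ := h
      exact ⟨a, ha, map_pow _ _ _⟩
    | one => exact ⟨1, K.one_mem, by simp⟩
    | mul x y hx hy ihx ihy =>
      obtain ⟨a, ha, hax⟩ := ihx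
      obtain ⟨b, hb, hby⟩ := ihy
      exact ⟨a * b, K.mul_mem ha hb, by rw [map_mul, map_mul, (hcomm a ha b).mul_pow, hax, hby]⟩
    | inv x hx ihx =>
      obtain ⟨a, ha, hax⟩ := ihx
      exact ⟨a⁻¹, K.inv_mem ha, by rw [map_inv, map_inv, inv_pow, hax]⟩
  have hroots : ∀ k : ℕ, ∀ x ∈ K, ∃ a ∈ K, π x = π a ^ p ^ k := by
    intro k
    induction k with
    | zero => exact fun x hx => ⟨x, hx, by simp⟩
    | succ k ih =>
      intro x hx
      obtain ⟨a, ha, hax⟩ := ih x hx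
      obtain ⟨b, hb, hba⟩ := hroot a ha
      exact ⟨b, hb, by rw [hax, hba, ← pow_mul, ← pow_succ']⟩
  intro x hx
  rw [← QuotientGroup.eq_one_iff, ← QuotientGroup.mk'_apply, ← hπ]
  obtain ⟨n, hn⟩ := isPGroup_iff_exists_pow_pow_eq_one.mp hG
  obtain ⟨a, -, ha⟩ := hroots n x hx
  rw [ha, ← map_pow, hn, map_one]

/-- In a chain of normal subgroups `N i` with `N (i + 1)` generated by the `p`-th powers of `N i`
and `⁅N i, G⁆ ≤ N (i + 1)`, every element of `N 1` is a `p`-th power of an element of `N 0`. -/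
theorem exists_pow_eq_of_mem_powersIn {p : ℕ} (hp : p.Prime) (hp2 : 2 < p) {G : Type*} [Group G]
    {N : ℕ → Subgroup G} [hN : ∀ i, (N i).Normal] (hpow : ∀ i, N (i + 1) = powersIn p (N i))
    (hcomm : ∀ i, ⁅N i, (⊤ : Subgroup G)⁆ ≤ N (i + 1)) {m : ℕ} (hm : N m = ⊥) {g : G}
    (hg : g ∈ N 1) : ∃ a ∈ N 0, a ^ p = g := by
  have hanti : Antitone N := antitone_nat_of_succ_le fun i => hpow i ▸ powersIn_le p (N i)
  have hmul : ∀ i a b, b ∈ N i → QuotientGroup.mk' (N (i + 2)) ((a * b) ^ p) =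
      QuotientGroup.mk' (N (i + 2)) (a ^ p * b ^ p) := by
    intro i a b hb
    have hu : ⁅b⁻¹, a⁻¹⁆ ∈ N (i + 1) := hcomm i
      (Subgroup.commutator_mem_commutator ((N i).inv_mem hb) (Subgroup.mem_top _))
    have hc : ∀ h, Commute (QuotientGroup.mk' (N (i + 2)) ⁅b⁻¹, a⁻¹⁆)
        (QuotientGroup.mk' (N (i + 2)) h) := by
      intro h
      rw [← commutatorElement_eq_one_iff_commute, ← map_commutatorElement, QuotientGroup.mk'_apply,
        QuotientGroup.eq_one_iff]
      exact hcomm (i + 1) (Subgroup.commutator_mem_commutator hu (Subgroup.mem_top h))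
    rw [map_pow, map_mul, map_mul, map_pow, map_pow]
    refine mul_pow_prime_of_central_commutator hp hp2 ?_ (hc a) (hc b) ?_
    · rw [← map_mul, ← map_mul, ← map_mul, commutatorElement_def]
      congr 1
      group
    · rw [← map_pow, QuotientGroup.mk'_apply, QuotientGroup.eq_one_iff, hpow (i + 1)]
      exact pow_mem_powersIn hu
  have hroot : ∀ i, ∀ x ∈ N (i + 1), ∃ b ∈ N i,
      QuotientGroup.mk' (N (i + 2)) x = QuotientGroup.mk' (N (i + 2)) (b ^ p) := by
    intro i x hx
    rw [hpow] at hx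
    induction hx using Subgroup.closure_induction with
    | mem x h =>
      obtain ⟨a, ha, rfl⟩ := h
      exact ⟨a, ha, rfl⟩
    | one => exact ⟨1, (N i).one_mem, by simp⟩
    | mul x y hx hy ihx ihy =>
      obtain ⟨a, ha, hax⟩ := ihx
      obtain ⟨b, hb, hby⟩ := ihy
      exact ⟨a * b, (N i).mul_mem ha hb, by rw [hmul i a b hb, map_mul, map_mul, hax, hby]⟩
    | inv x hx ihx =>
      obtain ⟨a, ha, hax⟩ := ihx
      exact ⟨a⁻¹, (N i).inv_mem ha, by rw [map_inv, inv_pow, map_inv, hax]⟩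
  have happrox : ∀ i, ∃ a ∈ N 0,
      QuotientGroup.mk' (N (i + 1)) g = QuotientGroup.mk' (N (i + 1)) (a ^ p) := by
    intro i
    induction i with
    | zero =>
      refine ⟨1, (N 0).one_mem, ?_⟩
      rw [one_pow, map_one, QuotientGroup.mk'_apply, QuotientGroup.eq_one_iff]
      exact hg
    | succ i ih =>
      obtain ⟨a, ha, h⟩ := ih
      have hy : (a ^ p)⁻¹ * g ∈ N (i + 1) := QuotientGroup.eq.mp h.symm
      obtain ⟨b, hb, hby⟩ := hroot i _ hy
      refine ⟨a * b, (N 0).mul_mem ha (hanti (Nat.zero_le i) hb), ?_⟩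
      rw [hmul i a b hb, map_mul, ← hby, ← map_mul]
      congr 1
      group
  obtain ⟨a, ha, h⟩ := happrox m
  refine ⟨a, ha, ?_⟩
  have h1 : (a ^ p)⁻¹ * g ∈ N m := hanti (Nat.le_succ m) (QuotientGroup.eq.mp h.symm)
  rw [hm, Subgroup.mem_bot] at h1
  exact inv_mul_eq_one.mp h1

/-- A chain of subgroups with `N 0` containing all commutators, `⁅N i, G⁆ ≤ N (i + 1)`, and
`N (i + 1)` equal to the set of `p`-th powers of elements of `N i`. -/
structure IsPowerFiltration (p : ℕ) {G : Type*} [Group G] (N : ℕ → Subgroup G) : Prop where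
  commutator_mem_zero : ∀ g h : G, ⁅g, h⁆ ∈ N 0
  commutator_mem : ∀ i, ∀ n ∈ N i, ∀ g : G, ⁅n, g⁆ ∈ N (i + 1)
  mem_succ_iff : ∀ i x, x ∈ N (i + 1) ↔ ∃ n ∈ N i, n ^ p = x

theorem exists_isPowerFiltration {p : ℕ} (hp : p.Prime) (hp2 : 2 < p) {G : Type*} [Group G]
    [Finite G] (hG : IsPGroup p G) (hQP : IsQuasiPowerful p G) :
    ∃ N : ℕ → Subgroup G, IsPowerFiltration p N := by
  have : Fact p.Prime := ⟨hp⟩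
  have : Group.IsNilpotent G := hG.isNilpotent
  set N : ℕ → Subgroup G := fun i => (powersIn p)^[i] (commutator G) with hN
  have hpow : ∀ i, N (i + 1) = powersIn p (N i) := fun i => Function.iterate_succ_apply' _ _ _
  have hnormal : ∀ i, (N i).Normal := by
    intro i
    induction i with
    | zero => exact (inferInstance : (commutator G).Normal)
    | succ i ih => rw [hpow]; infer_instance
  have hcomm : ∀ i, ⁅N i, (⊤ : Subgroup G)⁆ ≤ N (i + 1) := by
    intro i
    induction i with
    | zero =>
      have hle : ⁅commutator G, (⊤ : Subgroup G)⁆ ≤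
          ⁅powersIn p (⊤ : Subgroup G), (⊤ : Subgroup G)⁆ := by
        set K : Subgroup G := ⁅powersIn p (⊤ : Subgroup G), (⊤ : Subgroup G)⁆
        set C := (Subgroup.center (G ⧸ K)).comap (QuotientGroup.mk' K)
        have hZC : Subgroup.center G ≤ C := fun z hz => mem_comap_center_iff.mpr fun h => by
          have hzh : ⁅z, h⁆ = 1 :=
            commutatorElement_eq_one_iff_mul_comm.mpr (Subgroup.mem_center_iff.mp hz h).symm
          exact hzh ▸ K.one_mem
        have hpC : ∀ g : G, g ^ p ∈ C := fun g => mem_comap_center_iff.mpr fun h =>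
          Subgroup.commutator_mem_commutator (pow_mem_powersIn (Subgroup.mem_top g))
            (Subgroup.mem_top h)
        have hpowC : powSubgroup (G ⧸ Subgroup.center G) p ≤
            C.map (QuotientGroup.mk' (Subgroup.center G)) := by
          rw [powSubgroup, Subgroup.closure_le]
          rintro _ ⟨g, rfl⟩
          induction g using QuotientGroup.induction_on with
          | H g => exact ⟨g ^ p, hpC g, rfl⟩
        have hcomC : commutator G ≤ C := by
          refine Subgroup.commutator_le.mpr fun a _ b _ => ?_
          have h : QuotientGroup.mk' (Subgroup.center G) ⁅a, b⁆ ∈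
              commutator (G ⧸ Subgroup.center G) := by
            rw [map_commutatorElement]
            exact Subgroup.commutator_mem_commutator (Subgroup.mem_top _) (Subgroup.mem_top _)
          obtain ⟨c, hc, hcab⟩ := hpowC (hQP h)
          have h' := hZC (QuotientGroup.eq.mp hcab)
          simpa using C.mul_mem hc h'
        exact Subgroup.commutator_le.mpr fun a ha g _ => mem_comap_center_iff.mp (hcomC ha) g
      exact hle.trans (commutator_powersIn_le hp hp2 (N := ⊤) (M := commutator G) le_rfl hle)
    | succ i ih =>
      rw [hpow (i + 1), hpow i]
      rw [hpow] at ih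
      exact commutator_powersIn_le hp hp2 ih le_rfl
  have hbot : ∃ m, N m = ⊥ := by
    have hanti : Antitone N := antitone_nat_of_succ_le fun i => hpow i ▸ powersIn_le p (N i)
    obtain ⟨m, hm⟩ := WellFoundedLT.antitone_chain_condition hanti
    exact ⟨m, eq_bot_of_le_powersIn hG (N m) (by rw [← hpow, ← hm _ (Nat.le_succ m)])⟩
  obtain ⟨m, hm⟩ := hbot
  refine ⟨N, fun g h => Subgroup.commutator_mem_commutator (Subgroup.mem_top _)
    (Subgroup.mem_top _), fun i n hn g => hcomm i (Subgroup.commutator_mem_commutator hn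
    (Subgroup.mem_top g)), fun i x => ⟨fun hx => ?_, ?_⟩⟩
  · exact exists_pow_eq_of_mem_powersIn hp hp2 (N := fun j => N (i + j)) (fun j => hpow (i + j))
      (fun j => hcomm (i + j)) (m := m)
      (le_bot_iff.mp (hm ▸ (antitone_nat_of_succ_le fun i => hpow i ▸ powersIn_le p (N i) :
        Antitone N) (Nat.le_add_left m i))) hx
  · rintro ⟨n, hn, rfl⟩
    rw [hpow]
    exact pow_mem_powersIn hn

namespace IsPowerFiltration

variable {p : ℕ} {G : Type*} [Group G] {N : ℕ → Subgroup G}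

theorem pow_mem (hN : IsPowerFiltration p N) {i : ℕ} {n : G} (hn : n ∈ N i) (k : ℕ) :
    n ^ p ^ k ∈ N (i + k) := by
  induction k with
  | zero => simpa using hn
  | succ k ih => exact (hN.mem_succ_iff _ _).mpr ⟨_, ih, by rw [← pow_mul, ← pow_succ]⟩

theorem exists_root (hN : IsPowerFiltration p N) {k : ℕ} {x : G} (hx : x ∈ N k) :
    ∃ c ∈ N 0, c ^ p ^ k = x := by
  induction k generalizing x with
  | zero => exact ⟨x, hx, by simp⟩
  | succ k ih =>
    obtain ⟨n, hn, rfl⟩ := (hN.mem_succ_iff _ _).mp hx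
    obtain ⟨c, hc, rfl⟩ := ih hn
    exact ⟨c, hc, by rw [← pow_mul, ← pow_succ]⟩

theorem antitone (hN : IsPowerFiltration p N) : Antitone N := by
  refine antitone_nat_of_succ_le fun i x hx => ?_
  obtain ⟨n, hn, rfl⟩ := (hN.mem_succ_iff _ _).mp hx
  exact (N i).pow_mem hn p

theorem commutator_mem' (hN : IsPowerFiltration p N) {i : ℕ} {n : G} (hn : n ∈ N i) (g : G) :
    ⁅g, n⁆ ∈ N (i + 1) := by
  rw [← commutatorElement_inv]
  exact (N _).inv_mem (hN.commutator_mem i n hn g)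

theorem normal (hN : IsPowerFiltration p N) (i : ℕ) : (N i).Normal := by
  refine ⟨fun n hn g => ?_⟩
  have h := (N i).mul_mem (hN.antitone (Nat.le_succ i) (hN.commutator_mem' hn g)) hn
  rwa [commutatorElement_def, inv_mul_cancel_right] at h

theorem succ_zero_lt [Finite G] [Group.IsNilpotent G] (hG : IsPGroup p G)
    (hN : IsPowerFiltration p N) (h0 : N 0 ≠ ⊥) : N 1 < N 0 := by
  refine lt_of_le_of_ne (hN.antitone zero_le_one) fun h => h0 ?_
  have := hN.normal 0
  refine eq_bot_of_le_powersIn hG (N 0) fun x hx => ?_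
  rw [← h] at hx
  obtain ⟨n, hn, rfl⟩ := (hN.mem_succ_iff _ _).mp hx
  exact pow_mem_powersIn hn

theorem subgroupOf (hN : IsPowerFiltration p N) {M : Subgroup G} (hM : N 0 ≤ M) :
    IsPowerFiltration p fun i => (N i).subgroupOf M where
  commutator_mem_zero g h := hN.commutator_mem_zero (g : G) (h : G)
  commutator_mem i n hn g := hN.commutator_mem i (n : G) hn (g : G)
  mem_succ_iff i x := by
    rw [Subgroup.mem_subgroupOf, hN.mem_succ_iff]
    constructor
    · rintro ⟨n, hn, hnx⟩
      exact ⟨⟨n, hM (hN.antitone (Nat.zero_le i) hn)⟩, hn, Subtype.ext hnx⟩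
    · rintro ⟨n, hn, rfl⟩
      exact ⟨n, hn, rfl⟩

theorem map (hN : IsPowerFiltration p N) {H : Type*} [Group H] {f : G →* H}
    (hf : Function.Surjective f) : IsPowerFiltration p fun i => (N i).map f where
  commutator_mem_zero := by
    refine hf.forall₂.mpr fun g h => ?_
    rw [← map_commutatorElement]
    exact Subgroup.mem_map_of_mem f (hN.commutator_mem_zero g h)
  commutator_mem i := by
    rintro _ ⟨n, hn, rfl⟩
    refine hf.forall.mpr fun g => ?_
    rw [← map_commutatorElement]
    exact Subgroup.mem_map_of_mem f (hN.commutator_mem i n hn g)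
  mem_succ_iff i x := by
    constructor
    · rintro ⟨y, hy, rfl⟩
      obtain ⟨n, hn, rfl⟩ := (hN.mem_succ_iff _ _).mp hy
      exact ⟨f n, Subgroup.mem_map_of_mem f hn, (map_pow f n p).symm⟩
    · rintro ⟨_, ⟨n, hn, rfl⟩, rfl⟩
      exact ⟨n ^ p, (hN.mem_succ_iff _ _).mpr ⟨n, hn, rfl⟩, map_pow f n p⟩

theorem succ (hN : IsPowerFiltration p N) {x : G} (hx : Subgroup.zpowers x ⊔ N 0 = ⊤) :
    IsPowerFiltration p fun i => N (i + 1) where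
  commutator_mem_zero := by
    have := hN.normal 1
    set C := (Subgroup.center (G ⧸ N 1)).comap (QuotientGroup.mk' (N 1))
    have h0C : N 0 ≤ C := fun n hn => mem_comap_center_iff.mpr (hN.commutator_mem 0 n hn)
    have hxC : x ∈ C := by
      rw [mem_comap_center_iff]
      have hle : (⊤ : Subgroup G) ≤ (Subgroup.centralizer {QuotientGroup.mk' (N 1) x}).comap
          (QuotientGroup.mk' (N 1)) := by
        rw [← hx, sup_le_iff, Subgroup.zpowers_le]
        refine ⟨?_, fun n hn => ?_⟩
        · rw [Subgroup.mem_comap, Subgroup.mem_centralizer_singleton_iff]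
        · have h := Subgroup.mem_center_iff.mp (h0C hn) (QuotientGroup.mk' (N 1) x)
          rw [Subgroup.mem_comap, Subgroup.mem_centralizer_singleton_iff]
          exact h.symm
      intro h
      have hh := hle (Subgroup.mem_top h)
      rw [Subgroup.mem_comap, Subgroup.mem_centralizer_singleton_iff] at hh
      rw [← QuotientGroup.eq_one_iff, ← QuotientGroup.mk'_apply, map_commutatorElement,
        commutatorElement_eq_one_iff_mul_comm]
      exact hh.symm
    have hC_top : C = ⊤ := by
      rw [eq_top_iff, ← hx, sup_le_iff, Subgroup.zpowers_le]
      exact ⟨hxC, h0C⟩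
    exact fun g => mem_comap_center_iff.mp (show g ∈ C from hC_top ▸ Subgroup.mem_top g)
  commutator_mem i := hN.commutator_mem (i + 1)
  mem_succ_iff i := hN.mem_succ_iff (i + 1)

end IsPowerFiltration

/-- The elements of `G` of order dividing `p` are closed under multiplication. -/
def OmegaOneClosed (p : ℕ) (G : Type*) [Group G] : Prop :=
  ∀ x y : G, x ^ p = 1 → y ^ p = 1 → (x * y) ^ p = 1

/-- For all `k`, elements of order dividing `p ^ k` commute with the elements `c ^ p ^ k` of order
dividing `p` with `c ∈ N`. -/
def OmegaCommutesWithPowers (p : ℕ) {G : Type*} [Group G] (N : Subgroup G) : Prop :=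
  ∀ (k : ℕ) (x c : G), x ^ p ^ k = 1 → c ∈ N → c ^ p ^ (k + 1) = 1 → Commute x (c ^ p ^ k)

/-- The subgroup of elements of order dividing `p`. -/
def OmegaOneClosed.subgroup {p : ℕ} {G : Type*} [Group G] (h : OmegaOneClosed p G) :
    Subgroup G where
  carrier := {x | x ^ p = 1}
  one_mem' := one_pow p
  mul_mem' := h _ _
  inv_mem' := fun {x} hx => by
    change x ^ p = 1 at hx
    change x⁻¹ ^ p = 1
    rw [inv_pow, hx, inv_one]

theorem OmegaOneClosed.mem_subgroup {p : ℕ} {G : Type*} [Group G] (h : OmegaOneClosed p G)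
    {x : G} : x ∈ h.subgroup ↔ x ^ p = 1 :=
  Iff.rfl

instance {p : ℕ} {G : Type*} [Group G] (h : OmegaOneClosed p G) : h.subgroup.Normal :=
  ⟨fun n hn g => by
    rw [h.mem_subgroup] at hn ⊢
    rw [conj_pow, hn, mul_one, mul_inv_cancel]⟩

theorem IsPowerFiltration.omegaCommutesWithPowers {p : ℕ} (hp : p.Prime) (hp2 : 2 < p)
    {G : Type*} [Group G] [Finite G] (hG : IsPGroup p G) {N : ℕ → Subgroup G}
    (hN : IsPowerFiltration p N) (h : OmegaOneClosed p G)
    (hQ : OmegaCommutesWithPowers p ((N 0).map (QuotientGroup.mk' h.subgroup))) :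
    OmegaCommutesWithPowers p (N 0) := by
  obtain ⟨K, hK⟩ := isPGroup_iff_exists_pow_pow_eq_one.mp hG
  suffices hj : ∀ j k : ℕ, K ≤ k + j → ∀ x c : G, x ^ p ^ k = 1 → c ∈ N 0 →
      c ^ p ^ (k + 1) = 1 → Commute x (c ^ p ^ k) from fun k => hj K k (Nat.le_add_left K k)
  intro j
  induction j with
  | zero =>
    intro k hk x c _ _ _
    obtain ⟨d, rfl⟩ := Nat.exists_eq_add_of_le hk
    rw [pow_add p, pow_mul, hK, one_pow]
    exact Commute.one_right x
  | succ j ih =>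
    intro k hk x c hx hc hcp
    rcases k with _ | k
    · rw [pow_zero, pow_one] at hx
      exact hx ▸ Commute.one_left _
    set y := c ^ p ^ k with hy
    have hyN : y ∈ N k := by simpa using hN.pow_mem hc k
    have hyp : y ^ p ^ (k + 2) = 1 := by
      rw [hy, ← pow_mul, mul_comm, pow_mul, hcp, one_pow]
    have hb : ⁅x, y⁆ ^ p = 1 := by
      rw [← h.mem_subgroup, ← QuotientGroup.eq_one_iff, ← QuotientGroup.mk'_apply,
        map_commutatorElement, commutatorElement_eq_one_iff_commute, hy, map_pow]
      refine hQ k _ _ ?_ (Subgroup.mem_map_of_mem _ hc) ?_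
      · rw [← map_pow, QuotientGroup.mk'_apply, QuotientGroup.eq_one_iff, h.mem_subgroup,
          ← pow_mul, ← pow_succ, hx]
      · rw [← map_pow, QuotientGroup.mk'_apply, QuotientGroup.eq_one_iff, h.mem_subgroup,
          ← pow_mul, ← pow_succ, hcp]
    have hu : ⁅⁅x, y⁆, y⁆ ^ p = 1 := by
      rw [commutatorElement_def ⁅x, y⁆, mul_assoc, mul_assoc, ← mul_assoc y]
      exact h _ _ hb (by rw [conj_pow, inv_pow, hb]; group)
    obtain ⟨e, he, heu⟩ := hN.exists_root
      (hN.commutator_mem (k + 1) _ (hN.commutator_mem' hyN x) y)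
    have hcomm : ∀ t : G, t ^ p ^ (k + 2) = 1 → Commute ⁅⁅x, y⁆, y⁆ t := by
      intro t ht
      rw [← heu]
      refine (ih (k + 2) (by omega) t e ht he ?_).symm
      rw [pow_succ, pow_mul, heu, hu]
    have := commute_pow_prime hp hp2 hb (hcomm y hyp)
      (hcomm _ (by rw [pow_succ', pow_mul, hb, one_pow]))
    rwa [hy, ← pow_mul, ← pow_succ] at this

theorem IsPowerFiltration.omegaOneClosed_of_subgroups {p : ℕ} (hp : p.Prime) (hp3 : 3 < p)
    {G : Type*} [Group G] {N : ℕ → Subgroup G} (hN : IsPowerFiltration p N)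
    (hM : ∀ x : G, OmegaOneClosed p ↥(Subgroup.zpowers x ⊔ N 0) ∧
      OmegaCommutesWithPowers p ((N 0).subgroupOf (Subgroup.zpowers x ⊔ N 0))) :
    OmegaOneClosed p G := by
  intro x y hx hy
  have hle : ∀ t : G, N 0 ≤ Subgroup.zpowers t ⊔ N 0 := fun t => le_sup_right
  have hself : ∀ t : G, t ∈ Subgroup.zpowers t ⊔ N 0 := fun t =>
    le_sup_left (b := N 0) (Subgroup.mem_zpowers t)
  have hclosed : ∀ t : G, ∀ a ∈ Subgroup.zpowers t ⊔ N 0, ∀ b ∈ Subgroup.zpowers t ⊔ N 0,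
      a ^ p = 1 → b ^ p = 1 → (a * b) ^ p = 1 := fun t a ha b hb hap hbp =>
    congrArg Subtype.val ((hM t).1 ⟨a, ha⟩ ⟨b, hb⟩ (Subtype.ext hap) (Subtype.ext hbp))
  have hcomm : ∀ t : G, t ^ p = 1 → ∀ z ∈ N 1, z ^ p = 1 → Commute z t := by
    intro t ht z hz hzp
    obtain ⟨c, hc, rfl⟩ := (hN.mem_succ_iff _ _).mp hz
    have h := (hM t).2 1 ⟨t, hself t⟩ ⟨c, hle t hc⟩ (Subtype.ext (by simpa using ht)) hc
      (Subtype.ext (by simpa [pow_succ, pow_mul] using hzp))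
    have h' : t * c ^ p ^ 1 = c ^ p ^ 1 * t := congrArg Subtype.val h.eq
    rw [pow_one] at h'
    exact h'.symm
  set u := ⁅y⁻¹, x⁻¹⁆ with hu
  have huN : u ∈ N 0 := hN.commutator_mem_zero _ _
  have hup : u ^ p = 1 := by
    have e : u = (y⁻¹ * x⁻¹ * y⁻¹⁻¹) * x := by rw [hu, commutatorElement_def, inv_inv x]
    rw [e]
    refine hclosed x _ ?_ x (hself x) (by rw [conj_pow, inv_pow, hx]; group) hx
    have e' : y⁻¹ * x⁻¹ * y⁻¹⁻¹ = u * x⁻¹ := by rw [e]; group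
    rw [e']
    exact mul_mem (hle x huN) (inv_mem (hself x))
  have hcu : ∀ t : G, ⁅u⁻¹, t⁆ ∈ N 1 ∧ ⁅u⁻¹, t⁆ ^ p = 1 := by
    intro t
    refine ⟨hN.commutator_mem 0 _ (inv_mem huN) t, ?_⟩
    rw [commutatorElement_def, mul_assoc, mul_assoc, ← mul_assoc t]
    refine hclosed x _ (hle x (inv_mem huN)) _ (hle x ?_) (by rw [inv_pow, hup, inv_one]) ?_
    · exact (hN.normal 0).conj_mem _ (by simpa using huN) t
    · rw [conj_pow, inv_inv, hup]; group
  have hv := hcu x⁻¹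
  have hw := hcu y⁻¹
  have hform := mul_pow_eq_of_central_triple_commutators (x := x) (y := y) (u := u)
    (v := ⁅u⁻¹, x⁻¹⁆) (w := ⁅u⁻¹, y⁻¹⁆) (by rw [hu, commutatorElement_def]; group)
    (by rw [commutatorElement_def]; group) (by rw [commutatorElement_def]; group)
    (hcomm x hx _ hv.1 hv.2) (hcomm y hy _ hv.1 hv.2) (hcomm x hx _ hw.1 hw.2)
    (hcomm y hy _ hw.1 hw.2) p
  obtain ⟨i, hi⟩ := hp.dvd_choose_self (k := 2) (by norm_num) (by omega)
  obtain ⟨j, hj⟩ := hp.dvd_choose_self (k := 3) (by norm_num) hp3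
  have e : p * i + 2 * (p * j) = p * (i + 2 * j) := by ring
  rw [hform, hi, hj, e, pow_mul, pow_mul, pow_mul, hup, hv.2, hw.2, hx, hy]
  simp

theorem IsPowerFiltration.omegaOneClosed_and_commutes {p : ℕ} (hp : p.Prime) (hp3 : 3 < p)
    (n : ℕ) : ∀ (G : Type*) [Group G] [Finite G] (_ : IsPGroup p G) (N : ℕ → Subgroup G)
    (_ : IsPowerFiltration p N) (_ : Nat.card G + Nat.card (N 0) ≤ n),
    OmegaOneClosed p G ∧ OmegaCommutesWithPowers p (N 0) := by
  have : Fact p.Prime := ⟨hp⟩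
  induction n with
  | zero =>
    intro G _ _ _ N _ hn
    have := Nat.card_pos (α := G)
    omega
  | succ n ih =>
    intro G _ _ hG N hN hn
    have : Group.IsNilpotent G := hG.isNilpotent
    by_cases h0 : N 0 = ⊥
    · refine ⟨fun x y hx hy => ?_, fun k x c _ hc _ => ?_⟩
      · have hxy := hN.commutator_mem_zero x y
        rw [h0, Subgroup.mem_bot, commutatorElement_eq_one_iff_commute] at hxy
        rw [hxy.mul_pow, hx, hy, one_mul]
      · rw [h0, Subgroup.mem_bot] at hc
        rw [hc, one_pow]
        exact Commute.one_right x
    have hclosed : OmegaOneClosed p G := by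
      by_cases htop : ∃ x : G, Subgroup.zpowers x ⊔ N 0 = ⊤
      · obtain ⟨x, hx⟩ := htop
        have hlt : Nat.card (N 1) < Nat.card (N 0) :=
          Set.ncard_lt_ncard (hN.succ_zero_lt hG h0)
        exact (ih G hG _ (hN.succ hx) (by rw [zero_add]; omega)).1
      · refine hN.omegaOneClosed_of_subgroups hp hp3 fun x => ?_
        set M := Subgroup.zpowers x ⊔ N 0
        have hMtop : M ≠ ⊤ := fun h => htop ⟨x, h⟩
        have hlt : Nat.card M < Nat.card G :=
          lt_of_le_of_ne (Subgroup.card_le_card_group M)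
            fun h => hMtop (Subgroup.eq_top_of_card_eq M h)
        have hcard : Nat.card ((N 0).subgroupOf M) = Nat.card (N 0) :=
          Nat.card_congr (Subgroup.subgroupOfEquivOfLe le_sup_right).toEquiv
        exact ih M (hG.to_subgroup M) _ (hN.subgroupOf le_sup_right) (by omega)
    refine ⟨hclosed, hN.omegaCommutesWithPowers hp (by omega) hG hclosed ?_⟩
    set O := hclosed.subgroup
    have hmap : Nat.card ((N 0).map (QuotientGroup.mk' O)) ≤ Nat.card (N 0) :=
      Nat.card_le_card_of_surjective _
        ((QuotientGroup.mk' O).subgroupMap_surjective (N 0))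
    have hlt : Nat.card (G ⧸ O) < Nat.card G := by
      have hNt : Nontrivial G := by
        obtain ⟨g, -, hg⟩ := (N 0).ne_bot_iff_exists_ne_one.mp h0 |>.elim
          fun g hg => (⟨g.1, g.2, fun h => hg (Subtype.ext h)⟩ : ∃ g ∈ N 0, g ≠ 1)
        exact ⟨g, 1, hg⟩
      have hdvd : p ∣ Nat.card G := hG.card_eq_or_dvd.resolve_left
        Finite.one_lt_card.ne'
      obtain ⟨g, hg⟩ := exists_prime_orderOf_dvd_card' p hdvd
      have hO1 : 1 < Nat.card O := by
        rw [Subgroup.one_lt_card_iff_ne_bot]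
        intro hbot
        have hgO : g ∈ O := hclosed.mem_subgroup.mpr (hg ▸ pow_orderOf_eq_one g)
        rw [hbot, Subgroup.mem_bot] at hgO
        rw [hgO, orderOf_one] at hg
        exact hp.one_lt.ne hg
      rw [Subgroup.card_eq_card_quotient_mul_card_subgroup O]
      exact lt_mul_of_one_lt_right Nat.card_pos hO1
    exact (ih (G ⧸ O) (hG.to_quotient O) _ (hN.map (QuotientGroup.mk'_surjective O))
      (by omega)).2

theorem omega_one_exponent_p (p : ℕ) (hp : p.Prime) (hp3 : 3 < p)
    (G : Type*) [Group G] [Finite G]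
    (hG : IsPGroup p G) (hQP : IsQuasiPowerful p G) :
    ∀ x ∈ omegaSubgroup G p, x ^ p = 1 := by
  obtain ⟨N, hN⟩ := exists_isPowerFiltration hp (by omega) hG hQP
  have h := (IsPowerFiltration.omegaOneClosed_and_commutes hp hp3 _ G hG N hN le_rfl).1
  have hle : omegaSubgroup G p ≤ h.subgroup := (Subgroup.closure_le _).mpr fun _ hg => hg
  exact fun x hx => h.mem_subgroup.mp (hle hx)
end

section
/- Let G be a quasi-powerful 3-group (a finite 3-group such that G/Z(G) is powerful). Then Ω_1(G) has exponent dividing 3; that is, every element x ∈ Ω_1(G) satisfies x^3 = 1. -/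
open scoped commutatorElement

/-- If `⁅x, e⁆` commutes with `x` and `e`, and `e ^ 3` commutes with `x`, then cubing is
multiplicative on `e * x`. -/
theorem mul_pow_three_of_commute {G : Type*} [Group G] {e x : G} (hx : Commute ⁅x, e⁆ x)
    (he : Commute ⁅x, e⁆ e) (hc : Commute (e ^ 3) x) : (e * x) ^ 3 = e ^ 3 * x ^ 3 := by
  obtain ⟨f, hf⟩ : ∃ f, f = ⁅x, e⁆ := ⟨_, rfl⟩
  rw [← hf] at hx he
  have hxe : x * e * x⁻¹ = f * e := by rw [hf, commutatorElement_def]; group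
  have hf3 : f ^ 3 = 1 := by
    have h1 : x * e ^ 3 * x⁻¹ = f ^ 3 * e ^ 3 := by
      rw [← conj_pow, hxe, he.mul_pow]
    rw [← hc.eq, mul_inv_cancel_right] at h1
    exact right_eq_mul.mp h1
  have h2 : x * (f * e) * x⁻¹ = f * (f * e) := by
    rw [← mul_assoc, ← hx.eq, mul_assoc, mul_assoc, ← mul_assoc x, hxe]
  calc (e * x) ^ 3 = e * (x * e * x⁻¹) * (x * (x * e * x⁻¹) * x⁻¹) * x ^ 3 := by
        simp only [pow_succ, pow_zero, one_mul]; group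
    _ = (e * f) * (e * f) * (f * e) * x ^ 3 := by
        rw [hxe, h2]; simp only [mul_assoc]
    _ = f ^ 3 * e ^ 3 * x ^ 3 := by
        rw [← he.eq, ← he.mul_pow]; simp only [pow_succ, pow_zero, one_mul, mul_assoc]
    _ = e ^ 3 * x ^ 3 := by rw [hf3, one_mul]

theorem commutator_pow_three_right {G : Type*} [Group G] {u w : G}
    (hw : Commute ⁅w, ⁅u, w⁆⁆ w) (hd : Commute ⁅w, ⁅u, w⁆⁆ ⁅u, w⁆)
    (hc : Commute (⁅u, w⁆ ^ 3) w) : ⁅u, w ^ 3⁆ = ⁅u, w⁆ ^ 3 := by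
  have h := mul_pow_three_of_commute hw hd hc
  have h1 : ⁅u, w⁆ * w = u * w * u⁻¹ := by rw [commutatorElement_def]; group
  rw [h1, conj_pow] at h
  rw [commutatorElement_def u (w ^ 3), h, mul_inv_cancel_right]

/-- The series `G = G₀ ≥ G₁ ≥ …` where `Gᵢ₊₁` is generated by the cubes of elements of `Gᵢ`. -/
def cubeSeries (G : Type*) [Group G] : ℕ → Subgroup G
  | 0 => ⊤
  | i + 1 => Subgroup.closure {g : G | ∃ x ∈ cubeSeries G i, x ^ 3 = g}

section CubeSeries

variable {G : Type*} [Group G]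

theorem cubeSeries_succ_le_iff {i : ℕ} {K : Subgroup G} :
    cubeSeries G (i + 1) ≤ K ↔ ∀ x ∈ cubeSeries G i, x ^ 3 ∈ K := by
  rw [cubeSeries, Subgroup.closure_le]
  exact ⟨fun h x hx => h ⟨x, hx, rfl⟩, by rintro h _ ⟨x, hx, rfl⟩; exact h x hx⟩

theorem pow_three_mem_cubeSeries {i : ℕ} {x : G} (hx : x ∈ cubeSeries G i) :
    x ^ 3 ∈ cubeSeries G (i + 1) :=
  Subgroup.subset_closure ⟨x, hx, rfl⟩

instance cubeSeries_normal (i : ℕ) : (cubeSeries G i).Normal := by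
  induction i with
  | zero => exact inferInstanceAs (⊤ : Subgroup G).Normal
  | succ i ih =>
    refine ⟨fun n hn g => ?_⟩
    suffices h : cubeSeries G (i + 1) ≤
        (cubeSeries G (i + 1)).comap (MulAut.conj g).toMonoidHom from h hn
    refine cubeSeries_succ_le_iff.mpr fun x hx => ?_
    exact Subgroup.subset_closure ⟨g * x * g⁻¹, ih.conj_mem x hx g, conj_pow⟩

theorem cubeSeries_succ_le (i : ℕ) : cubeSeries G (i + 1) ≤ cubeSeries G i :=
  cubeSeries_succ_le_iff.mpr fun _ hx => pow_mem hx 3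

theorem commute_mk_of_commutator_mem {N : Subgroup G} [N.Normal] {x y : G} (h : ⁅x, y⁆ ∈ N) :
    Commute (x : G ⧸ N) (y : G ⧸ N) := by
  rw [← commutatorElement_eq_one_iff_commute]
  exact (QuotientGroup.eq_one_iff _).mpr h

theorem commutator_mem_of_commute_mk {N : Subgroup G} [N.Normal] {x y : G}
    (h : Commute (x : G ⧸ N) (y : G ⧸ N)) : ⁅x, y⁆ ∈ N := by
  rw [← commutatorElement_eq_one_iff_commute] at h
  exact (QuotientGroup.eq_one_iff _).mp h

theorem le_of_le_sup_commutator_s16 [Group.IsNilpotent G] {A B : Subgroup G} [A.Normal] [B.Normal]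
    (h : A ≤ B ⊔ ⁅A, (⊤ : Subgroup G)⁆) : A ≤ B := by
  have key : ∀ n, A ≤ B ⊔ (⊤ : Subgroup G).lowerCentralSeries n := by
    intro n
    induction n with
    | zero => simp
    | succ n ih =>
      refine h.trans (sup_le le_sup_left ?_)
      rw [Subgroup.commutator_le]
      intro a ha g _
      obtain ⟨b, hb, c, hc, rfl⟩ := Subgroup.mem_sup_of_normal_left.mp (ih ha)
      rw [commutatorElement_mul_left_eq_conj_mul]
      have hc' : ⁅c, g⁆ ∈ (⊤ : Subgroup G).lowerCentralSeries (n + 1) :=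
        Subgroup.commutator_mem_commutator hc (Subgroup.mem_top g)
      have hb' : ⁅b, g⁆ ∈ B :=
        Subgroup.commutator_le_left B ⊤ (Subgroup.commutator_mem_commutator hb (Subgroup.mem_top g))
      exact mul_mem (Subgroup.mem_sup_right (Subgroup.Normal.conj_mem inferInstance _ hc' b))
        (Subgroup.mem_sup_left hb')
  obtain ⟨n, hn⟩ := Subgroup.nilpotent_iff_lowerCentralSeries.mp ‹Group.IsNilpotent G›
  simpa [hn] using key n

/-- In a nilpotent powerful group the cube series is a central series. -/
theorem commutator_mem_cubeSeries_succ [Group.IsNilpotent G] (hp : IsPowerful 3 G) (i : ℕ) :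
    ∀ {x : G}, x ∈ cubeSeries G i → ∀ g : G, ⁅x, g⁆ ∈ cubeSeries G (i + 1) := by
  induction i with
  | zero =>
    intro x _ g
    have h1 : ⁅x, g⁆ ∈ commutator G :=
      Subgroup.commutator_mem_commutator (Subgroup.mem_top x) (Subgroup.mem_top g)
    have h2 : powSubgroup G 3 ≤ cubeSeries G 1 :=
      Subgroup.closure_mono (by rintro _ ⟨y, rfl⟩; exact ⟨y, Subgroup.mem_top y, rfl⟩)
    exact h2 (hp h1)
  | succ i ih =>
    intro x hx g
    let A : Subgroup G := ⁅cubeSeries G (i + 1), (⊤ : Subgroup G)⁆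
    let C : Subgroup G := cubeSeries G (i + 2) ⊔ ⁅A, (⊤ : Subgroup G)⁆
    suffices hA : A ≤ cubeSeries G (i + 2) from
      hA (Subgroup.commutator_mem_commutator hx (Subgroup.mem_top g))
    apply le_of_le_sup_commutator_s16
    change A ≤ C
    have hC : cubeSeries G (i + 1) ≤ (Subgroup.center (G ⧸ C)).comap (QuotientGroup.mk' C) := by
      refine cubeSeries_succ_le_iff.mpr fun y hy => ?_
      refine Subgroup.mem_center_iff.mpr fun q => ?_
      induction q using QuotientGroup.induction_on with | H k =>
      have he : ⁅k, y⁆ ∈ cubeSeries G (i + 1) := by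
        rw [← commutatorElement_inv]; exact inv_mem (ih hy k)
      have hf : ⁅y, ⁅k, y⁆⁆ ∈ A := by
        rw [← commutatorElement_inv]
        exact inv_mem (Subgroup.commutator_mem_commutator he (Subgroup.mem_top y))
      have hfc : ∀ t : G, Commute ((⁅y, ⁅k, y⁆⁆ : G) : G ⧸ C) (t : G ⧸ C) := fun t =>
        commute_mk_of_commutator_mem (N := C) (Subgroup.mem_sup_right
          (Subgroup.commutator_mem_commutator hf (Subgroup.mem_top t)))
      have he3 : ⁅(k : G ⧸ C), (y : G ⧸ C)⁆ ^ 3 = 1 :=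
        (QuotientGroup.eq_one_iff (N := C) (⁅k, y⁆ ^ 3)).mpr (Subgroup.mem_sup_left (pow_three_mem_cubeSeries he))
      have h := commutator_pow_three_right (u := (k : G ⧸ C)) (w := (y : G ⧸ C)) (hfc y)
        (hfc ⁅k, y⁆) (by rw [he3]; exact Commute.one_left _)
      rw [he3, commutatorElement_eq_one_iff_commute] at h
      exact h.eq
    rw [Subgroup.commutator_le]
    intro a ha g _
    have := Subgroup.mem_center_iff.mp (hC ha) (g : G ⧸ C)
    exact commutator_mem_of_commute_mk (N := C) (Commute.symm this)

theorem commute_mk_cubeSeries [Group.IsNilpotent G] (hp : IsPowerful 3 G) {i : ℕ} {x : G}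
    (hx : x ∈ cubeSeries G i) (g : G) :
    Commute (x : G ⧸ cubeSeries G (i + 1)) (g : G ⧸ cubeSeries G (i + 1)) :=
  commute_mk_of_commutator_mem (commutator_mem_cubeSeries_succ hp i hx g)

theorem mk_mul_pow_three [Group.IsNilpotent G] (hp : IsPowerful 3 G) {i : ℕ} {y : G}
    (hy : y ∈ cubeSeries G i) (x : G) :
    (((y * x) ^ 3 : G) : G ⧸ cubeSeries G (i + 2)) = ((y ^ 3 * x ^ 3 : G) : _) := by
  have hf : ⁅x, y⁆ ∈ cubeSeries G (i + 1) := by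
    rw [← commutatorElement_inv]; exact inv_mem (commutator_mem_cubeSeries_succ hp i hy x)
  exact mul_pow_three_of_commute (e := (y : G ⧸ cubeSeries G (i + 2)))
    (x := (x : G ⧸ cubeSeries G (i + 2))) (commute_mk_cubeSeries hp hf x)
    (commute_mk_cubeSeries hp hf y) (commute_mk_cubeSeries hp (pow_three_mem_cubeSeries hy) x)

theorem cubeSeries_antitone : Antitone (cubeSeries G) :=
  antitone_nat_of_succ_le cubeSeries_succ_le

theorem IsPGroup.exists_ne_top_forall_pow_mem {P : Type*} [Group P] [Finite P] [Nontrivial P]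
    {p : ℕ} [hp : Fact p.Prime] (hP : IsPGroup p P) : ∃ K : Subgroup P, K ≠ ⊤ ∧ ∀ x, x ^ p ∈ K := by
  obtain ⟨n, hn0, hn⟩ := hP.nontrivial_iff_card.mp inferInstance
  obtain ⟨m, rfl⟩ := Nat.exists_eq_succ_of_ne_zero hn0.ne'
  obtain ⟨K, hK⟩ := Sylow.exists_subgroup_card_pow_prime (G := P) p (n := m)
    (hn ▸ pow_dvd_pow p m.le_succ)
  have hidx : K.index = p := by
    have h := K.card_mul_index
    rw [hK, hn, Nat.succ_eq_add_one, pow_succ] at h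
    exact Nat.eq_of_mul_eq_mul_left (pow_pos hp.out.pos m) h
  have : K.Normal := Subgroup.normal_of_index_eq_minFac_card
    (by rw [hidx, hn, hp.out.pow_minFac m.succ_ne_zero])
  refine ⟨K, fun h => hp.out.one_lt.ne ?_, fun x => hidx ▸ K.pow_index_mem x⟩
  rw [← hidx, h, Subgroup.index_top]

theorem cubeSeries_succ_lt [Finite G] (hG : IsPGroup 3 G) {n : ℕ} (hn : cubeSeries G n ≠ ⊥) :
    cubeSeries G (n + 1) < cubeSeries G n := by
  have : Fact (Nat.Prime 3) := ⟨Nat.prime_three⟩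
  have : Nontrivial (cubeSeries G n) := (Subgroup.nontrivial_iff_ne_bot _).mpr hn
  obtain ⟨K, hK, hpow⟩ := (hG.to_subgroup (cubeSeries G n)).exists_ne_top_forall_pow_mem
  refine lt_of_le_of_lt (b := K.map (cubeSeries G n).subtype) ?_ ?_
  · refine cubeSeries_succ_le_iff.mpr fun x hx => ?_
    exact ⟨⟨x, hx⟩ ^ 3, hpow _, rfl⟩
  · refine lt_of_le_of_ne (Subgroup.map_subtype_le K) fun h => hK ?_
    refine eq_top_iff.mpr fun x _ => ?_
    obtain ⟨y, hy, hyx⟩ := h.ge x.2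
    exact Subtype.ext hyx ▸ hy

theorem exists_cubeSeries_eq_bot [Finite G] (hG : IsPGroup 3 G) : ∃ n, cubeSeries G n = ⊥ := by
  by_contra! h
  exact not_strictAnti_of_wellFoundedLT _ (strictAnti_nat_of_succ_lt fun n =>
    cubeSeries_succ_lt hG (h n))

theorem exists_mk_eq_mk_pow_three [Group.IsNilpotent G] (hp : IsPowerful 3 G) {i : ℕ} {x : G}
    (hx : x ∈ cubeSeries G (i + 1)) :
    ∃ y ∈ cubeSeries G i, (x : G ⧸ cubeSeries G (i + 2)) = ((y ^ 3 : G) : _) := by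
  rw [cubeSeries] at hx
  induction hx using Subgroup.closure_induction with
  | mem x hx =>
    obtain ⟨y, hy, rfl⟩ := hx
    exact ⟨y, hy, rfl⟩
  | one => exact ⟨1, one_mem _, by simp⟩
  | mul a b _ _ iha ihb =>
    obtain ⟨y, hy, hay⟩ := iha
    obtain ⟨t, ht, hbt⟩ := ihb
    exact ⟨y * t, mul_mem hy ht, by
      rw [mk_mul_pow_three hp hy t, QuotientGroup.mk_mul, QuotientGroup.mk_mul, hay, hbt]⟩
  | inv a _ iha =>
    obtain ⟨y, hy, hay⟩ := iha
    exact ⟨y⁻¹, inv_mem hy, by rw [inv_pow, QuotientGroup.mk_inv, QuotientGroup.mk_inv, hay]⟩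

theorem exists_pow_three_eq [Finite G] (hG : IsPGroup 3 G) (hp : IsPowerful 3 G) {i : ℕ} {x : G}
    (hx : x ∈ cubeSeries G (i + 1)) : ∃ y ∈ cubeSeries G i, y ^ 3 = x := by
  have : Group.IsNilpotent G := by
    have : Fact (Nat.Prime 3) := ⟨Nat.prime_three⟩
    exact hG.isNilpotent
  have key : ∀ n, ∃ y ∈ cubeSeries G i, x * (y ^ 3)⁻¹ ∈ cubeSeries G (i + n + 1) := by
    intro n
    induction n with
    | zero => exact ⟨1, one_mem _, by simpa using hx⟩
    | succ n ih =>
      obtain ⟨y, hy, hw⟩ := ih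
      obtain ⟨t, ht, htw⟩ := exists_mk_eq_mk_pow_three hp hw
      refine ⟨t * y, mul_mem (cubeSeries_antitone (Nat.le_add_right i n) ht) hy, ?_⟩
      rw [← QuotientGroup.eq_one_iff, QuotientGroup.mk_mul, QuotientGroup.mk_inv, mul_inv_eq_one]
      refine Eq.trans ?_ (mk_mul_pow_three hp ht y).symm
      refine Eq.trans ?_ (congrArg (· * ((y ^ 3 : G) : G ⧸ cubeSeries G (i + n + 2))) htw)
      exact congrArg _ (by group)
  obtain ⟨n, hn⟩ := exists_cubeSeries_eq_bot hG
  obtain ⟨y, hy, hxy⟩ := key n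
  have h := cubeSeries_antitone (show n ≤ i + n + 1 by lia) hxy
  rw [hn, Subgroup.mem_bot, mul_inv_eq_one] at h
  exact ⟨y, hy, h.symm⟩

theorem exists_pow_eq_of_mem_cubeSeries [Finite G] (hG : IsPGroup 3 G) (hp : IsPowerful 3 G)
    {i : ℕ} : ∀ {x : G}, x ∈ cubeSeries G i → ∃ y, y ^ 3 ^ i = x := by
  induction i with
  | zero => exact fun {x} _ => ⟨x, by simp⟩
  | succ i ih =>
    intro x hx
    obtain ⟨y, hy, rfl⟩ := exists_pow_three_eq hG hp hx
    obtain ⟨t, rfl⟩ := ih hy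
    exact ⟨t, by rw [pow_succ, pow_mul]⟩

theorem commutator_mem_cubeSeries [Finite G] (hG : IsPGroup 3 G) (hp : IsPowerful 3 G)
    {a b : ℕ} {y : G} (hy : y ∈ cubeSeries G b) :
    ∀ {x : G}, x ∈ cubeSeries G a → ⁅y, x⁆ ∈ cubeSeries G (a + b + 1) := by
  have : Group.IsNilpotent G := by
    have : Fact (Nat.Prime 3) := ⟨Nat.prime_three⟩
    exact hG.isNilpotent
  induction a with
  | zero => intro x _; simpa using commutator_mem_cubeSeries_succ hp b hy x
  | succ a ih =>
    intro x hx
    obtain ⟨x, hx', rfl⟩ := exists_pow_three_eq hG hp hx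
    have he := ih hx'
    have e1 : a + 1 + b + 1 = a + b + 1 + 1 := by ring
    rw [e1]
    have he3 : ⁅(y : G ⧸ cubeSeries G (a + b + 1 + 1)),
        (x : G ⧸ cubeSeries G (a + b + 1 + 1))⁆ ^ 3 = 1 :=
      (QuotientGroup.eq_one_iff (⁅y, x⁆ ^ 3)).mpr (pow_three_mem_cubeSeries he)
    have hf : ⁅(x : G ⧸ cubeSeries G (a + b + 1 + 1)),
        ⁅(y : G ⧸ cubeSeries G (a + b + 1 + 1)), (x : G ⧸ cubeSeries G (a + b + 1 + 1))⁆⁆ = 1 := by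
      rw [commutatorElement_eq_one_iff_commute]
      exact (commute_mk_cubeSeries hp he x).symm
    have h := commutator_pow_three_right (u := (y : G ⧸ cubeSeries G (a + b + 1 + 1)))
      (w := (x : G ⧸ cubeSeries G (a + b + 1 + 1)))
      (by rw [hf]; exact Commute.one_left _) (by rw [hf]; exact Commute.one_left _)
      (by rw [he3]; exact Commute.one_left _)
    rw [he3] at h
    exact (QuotientGroup.eq_one_iff ⁅y, x ^ 3⁆).mp h

end CubeSeries

theorem IsPowerful.of_surjective {p : ℕ} {G Q : Type*} [Group G] [Group Q] (hG : IsPowerful p G)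
    {f : G →* Q} (hf : Function.Surjective f) : IsPowerful p Q := by
  have h1 : commutator Q = (commutator G).map f := by
    rw [commutator_def, commutator_def, Subgroup.map_commutator,
      Subgroup.map_top_of_surjective f hf]
  rw [IsPowerful, h1, Subgroup.map_le_iff_le_comap]
  refine hG.trans ?_
  rw [powSubgroup, Subgroup.closure_le]
  rintro _ ⟨g, rfl⟩
  exact Subgroup.subset_closure ⟨f g, (map_pow f g p).symm⟩

theorem IsQuasiPowerful.quotient {p : ℕ} {G : Type*} [Group G] (hG : IsQuasiPowerful p G)
    (N : Subgroup G) [N.Normal] : IsQuasiPowerful p (G ⧸ N) := by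
  refine IsPowerful.of_surjective (f := QuotientGroup.map (Subgroup.center G)
    (Subgroup.center (G ⧸ N)) (QuotientGroup.mk' N) ?_) hG ?_
  · intro z hz
    refine Subgroup.mem_center_iff.mpr fun q => ?_
    induction q using QuotientGroup.induction_on with | H k =>
    exact congrArg (QuotientGroup.mk' N) (Subgroup.mem_center_iff.mp hz k)
  · intro q
    induction q using QuotientGroup.induction_on with | H q =>
    induction q using QuotientGroup.induction_on with | H k =>
    exact ⟨(k : G ⧸ Subgroup.center G), rfl⟩

/-- The property that `l ^ 3 ^ (i + 1) ∈ Z(G)` and `h ^ 3 ^ i ∈ Z(G)` force `l ^ 3 ^ a` and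
`h ^ 3 ^ b` to commute whenever `a + b = i`. -/
def PowersCommute (G : Type*) [Group G] (i : ℕ) : Prop :=
  ∀ l h : G, l ^ 3 ^ (i + 1) ∈ Subgroup.center G → h ^ 3 ^ i ∈ Subgroup.center G →
    ∀ a b : ℕ, a + b = i → Commute (l ^ 3 ^ a) (h ^ 3 ^ b)

/-- The power structure of a quasi-powerful group, modulo its centre. -/
theorem IsQuasiPowerful.exists_series {G : Type*} [Group G] [Finite G] (hG : IsPGroup 3 G)
    (hQP : IsQuasiPowerful 3 G) : ∃ K : ℕ → Subgroup G,
      (∀ (l : G) (a : ℕ), l ^ 3 ^ a ∈ K a) ∧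
      (∀ a b : ℕ, ∀ x ∈ K a, ∀ y ∈ K b, ⁅x, y⁆ ∈ K (a + b + 1)) ∧
      ∀ i, ∀ x ∈ K i, ∃ q, ∃ z ∈ Subgroup.center G, x = q ^ 3 ^ i * z := by
  have hH : IsPGroup 3 (G ⧸ Subgroup.center G) := hG.to_quotient _
  refine ⟨fun i => (cubeSeries (G ⧸ Subgroup.center G) i).comap
    (QuotientGroup.mk' (Subgroup.center G)), fun l a => ?_, fun a b x hx y hy => ?_,
    fun i x hx => ?_⟩
  · induction a with
    | zero => exact Subgroup.mem_top _
    | succ a ih =>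
      rw [pow_succ, pow_mul]
      exact pow_three_mem_cubeSeries ih
  · rw [add_comm a b]
    exact commutator_mem_cubeSeries hH hQP hx hy
  · obtain ⟨q, hq⟩ := exists_pow_eq_of_mem_cubeSeries hH hQP hx
    induction q using QuotientGroup.induction_on with | H q =>
    exact ⟨q, (q ^ 3 ^ i)⁻¹ * x, QuotientGroup.eq.mp hq, by group⟩

/-- The elements whose cube is central, as a subgroup, provided that the elements of cube `1` in
the central quotient are closed under multiplication. -/
def centralCubeSubgroup (G : Type*) [Group G]
    (h : ∀ x y : G ⧸ Subgroup.center G, x ^ 3 = 1 → y ^ 3 = 1 → (x * y) ^ 3 = 1) :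
    Subgroup G where
  carrier := {g | g ^ 3 ∈ Subgroup.center G}
  one_mem' := by simp
  mul_mem' {a b} ha hb := by
    have h1 := h a b ((QuotientGroup.eq_one_iff _).mpr ha) ((QuotientGroup.eq_one_iff _).mpr hb)
    exact (QuotientGroup.eq_one_iff ((a * b) ^ 3)).mp h1
  inv_mem' {a} ha := by
    simpa only [Set.mem_ofPred_eq, inv_pow, inv_mem_iff] using ha

section CentralCube

variable {G : Type*} [Group G]
  {h : ∀ x y : G ⧸ Subgroup.center G, x ^ 3 = 1 → y ^ 3 = 1 → (x * y) ^ 3 = 1}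

theorem mem_centralCubeSubgroup {g : G} :
    g ∈ centralCubeSubgroup G h ↔ g ^ 3 ∈ Subgroup.center G := Iff.rfl

instance centralCubeSubgroup_normal : (centralCubeSubgroup G h).Normal :=
  ⟨fun n hn g => by
    rw [mem_centralCubeSubgroup, conj_pow]
    exact Subgroup.Normal.conj_mem (H := Subgroup.center G) inferInstance _ hn g⟩

theorem commutator_mem_centralCubeSubgroup {x : G} (hx : x ∈ centralCubeSubgroup G h) (g : G) :
    ⁅g, x⁆ ∈ centralCubeSubgroup G h :=
  mul_mem (Subgroup.Normal.conj_mem inferInstance _ hx g) (inv_mem hx)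

end CentralCube

theorem commute_of_mem_center_left {G : Type*} [Group G] {z : G} (hz : z ∈ Subgroup.center G)
    (g : G) : Commute z g :=
  (Subgroup.mem_center_iff.mp hz g).symm

theorem pow_mem_of_pow_mem {G : Type*} [Group G] {Z : Subgroup G} {x : G} {m n : ℕ} (hmn : m ≤ n)
    (hx : x ^ 3 ^ m ∈ Z) : x ^ 3 ^ n ∈ Z := by
  obtain ⟨k, rfl⟩ := Nat.exists_eq_add_of_le hmn
  rw [pow_add, pow_mul]
  exact pow_mem hx _

theorem powersCommute_zero (G : Type*) [Group G] : PowersCommute G 0 := by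
  intro l h _ hh a b hab
  obtain rfl : b = 0 := by lia
  exact (commute_of_mem_center_left hh _).symm

theorem powersCommute_of_le {G : Type*} [Group G] {s i : ℕ} (hs : ∀ g : G, g ^ 3 ^ s = 1)
    (hi : 2 * s ≤ i) : PowersCommute G i := by
  have h1 : ∀ (g : G) (t : ℕ), s ≤ t → g ^ 3 ^ t = 1 := fun g t hst =>
    Subgroup.mem_bot.mp (pow_mem_of_pow_mem hst (Subgroup.mem_bot.mpr (hs g)))
  intro l h _ _ a b hab
  rcases le_total s a with ha | hb
  · rw [h1 l a ha]; exact Commute.one_left _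
  · rw [h1 h b (by lia)]; exact Commute.one_right _

/-- The descending step of the induction: a cube may be moved from one entry of a commutator to the
other. -/
theorem PowersCommute.of_succ {G : Type*} [Group G] [Finite G] (hG : IsPGroup 3 G)
    (hQP : IsQuasiPowerful 3 G)
    (hmul : ∀ x y : G ⧸ Subgroup.center G, x ^ 3 = 1 → y ^ 3 = 1 → (x * y) ^ 3 = 1) {j : ℕ}
    (hN : PowersCommute (G ⧸ centralCubeSubgroup G hmul) j) (hsucc : PowersCommute G (j + 2)) :
    PowersCommute G (j + 1) := by
  obtain ⟨K, hKpow, hKcomm, hK⟩ := hQP.exists_series hG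
  intro l h hl hh
  have move : ∀ a b, a + b = j → ⁅l ^ 3 ^ (a + 1), h ^ 3 ^ b⁆ = ⁅l ^ 3 ^ a, h ^ 3 ^ (b + 1)⁆ := by
    intro a b hab
    have hu : (l ^ 3 ^ a) ^ 3 ^ (j + 2) ∈ Subgroup.center G := by
      rw [← pow_mul, ← pow_add]; exact pow_mem_of_pow_mem (by lia) hl
    have hw : (h ^ 3 ^ b) ^ 3 ^ (j + 2) ∈ Subgroup.center G := by
      rw [← pow_mul, ← pow_add]; exact pow_mem_of_pow_mem (by lia) hh
    have hdN : ⁅l ^ 3 ^ a, h ^ 3 ^ b⁆ ∈ centralCubeSubgroup G hmul := by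
      refine commutator_mem_of_commute_mk (N := centralCubeSubgroup G hmul)
        (hN (l : G ⧸ _) (h : G ⧸ _) ?_ ?_ a b hab)
      · rw [← QuotientGroup.mk_pow, (QuotientGroup.eq_one_iff _).mpr]
        · exact one_mem _
        · rw [mem_centralCubeSubgroup, ← pow_mul, ← pow_succ]; exact hl
      · rw [← QuotientGroup.mk_pow, (QuotientGroup.eq_one_iff _).mpr]
        · exact one_mem _
        · rw [mem_centralCubeSubgroup, ← pow_mul, ← pow_succ]; exact hh
    have hdK := hKcomm a b _ (hKpow l a) _ (hKpow h b)
    rw [pow_succ 3 a, pow_mul, pow_succ 3 b, pow_mul]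
    generalize l ^ 3 ^ a = u at *
    generalize h ^ 3 ^ b = w at *
    have hd3 : ∀ t, Commute (⁅u, w⁆ ^ 3) t := commute_of_mem_center_left hdN
    have hcomm : ∀ t t' : G, t' ^ 3 ^ (j + 2) ∈ Subgroup.center G → Commute ⁅t, ⁅u, w⁆⁆ t' := by
      intro t t' ht'
      have he := hKcomm 0 (a + b + 1) t (by simpa using hKpow t 0) _ hdK
      rw [show 0 + (a + b + 1) + 1 = j + 2 by lia] at he
      obtain ⟨q, z, hz, hq⟩ := hK _ _ he
      have heN : ⁅t, ⁅u, w⁆⁆ ^ 3 ∈ Subgroup.center G := commutator_mem_centralCubeSubgroup hdN t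
      rw [hq, (commute_of_mem_center_left hz _).symm.mul_pow, ← pow_mul, ← pow_succ,
        Subgroup.mul_mem_cancel_right _ (pow_mem hz 3)] at heN
      have := hsucc q t' heN ht' (j + 2) 0 rfl
      rw [hq]
      exact Commute.mul_left (by simpa using this) (commute_of_mem_center_left hz _)
    have hd : ⁅u, w⁆ ^ 3 ^ (j + 2) ∈ Subgroup.center G :=
      pow_mem_of_pow_mem (m := 1) (by lia) hdN
    rw [commutator_pow_three_right (hcomm w w hw) (hcomm w _ hd) (hd3 w)]
    have hd' : ⁅w, u⁆ = ⁅u, w⁆⁻¹ := (commutatorElement_inv u w).symm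
    have he : ⁅u, ⁅w, u⁆⁆ = ⁅u, ⁅u, w⁆⁆⁻¹ := by
      rw [hd', commutatorElement_inv_right, mul_assoc, ← commutatorElement_inv u,
        (hcomm u _ hd).inv_left.eq, inv_mul_cancel_left]
    rw [← commutatorElement_inv, commutator_pow_three_right
      (by rw [he]; exact (hcomm u u hu).inv_left)
      (by rw [he, hd']; exact (hcomm u _ hd).inv_inv)
      (by rw [hd', inv_pow]; exact (hd3 u).inv_left), hd', inv_pow, inv_inv]
  intro a
  induction a with
  | zero =>
    intro b hb
    obtain rfl : b = j + 1 := by lia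
    exact (commute_of_mem_center_left hh _).symm
  | succ a ih =>
    intro b hb
    rw [← commutatorElement_eq_one_iff_commute, move a b (by lia),
      commutatorElement_eq_one_iff_commute]
    exact ih (b + 1) (by lia)

theorem quasiPowerful_powersCommute_and_mul_pow_three (n : ℕ) :
    ∀ (G : Type*) [Group G] [Finite G], Nat.card G = n → IsPGroup 3 G → IsQuasiPowerful 3 G →
      (∀ i, PowersCommute G i) ∧ ∀ x y : G, x ^ 3 = 1 → y ^ 3 = 1 → (x * y) ^ 3 = 1 := by
  induction n using Nat.strong_induction_on with | h n ih =>
  intro G _ _ hn hG hQP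
  subst hn
  rcases subsingleton_or_nontrivial G with hs | hs
  · exact ⟨fun i l h _ _ a b _ => Subsingleton.elim _ _, fun x y _ _ => Subsingleton.elim _ _⟩
  have : Fact (Nat.Prime 3) := ⟨Nat.prime_three⟩
  have hquot : ∀ (N : Subgroup G) [N.Normal], Subgroup.center G ≤ N →
      Nat.card (G ⧸ N) < Nat.card G := by
    intro N _ hN
    have hZ : Nontrivial (Subgroup.center G) := hG.center_nontrivial
    have hN1 : 1 < Nat.card N := by
      refine (Subgroup.one_lt_card_iff_ne_bot N).mpr fun h => ?_
      exact (Subgroup.nontrivial_iff_ne_bot _).mp hZ (le_bot_iff.mp (h ▸ hN))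
    rw [Subgroup.card_eq_card_quotient_mul_card_subgroup N]
    exact lt_mul_of_one_lt_right Nat.card_pos hN1
  have hmul := (ih _ (hquot (Subgroup.center G) le_rfl) (G ⧸ Subgroup.center G) rfl
    (hG.to_quotient _) (hQP.quotient _)).2
  have hN := (ih _ (hquot (centralCubeSubgroup G hmul) fun z hz => pow_mem hz 3)
    (G ⧸ centralCubeSubgroup G hmul) rfl (hG.to_quotient _) (hQP.quotient _)).1
  obtain ⟨s, hs⟩ := IsPGroup.iff_card.mp hG
  have hs' : ∀ g : G, g ^ 3 ^ s = 1 := fun g => hs ▸ pow_card_eq_one'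
  have hC : ∀ k i, 2 * s ≤ i + k → PowersCommute G i := by
    intro k
    induction k with
    | zero => exact fun i hi => powersCommute_of_le hs' hi
    | succ k ihk =>
      intro i hi
      cases i with
      | zero => exact powersCommute_zero G
      | succ j => exact PowersCommute.of_succ hG hQP hmul (hN j) (ihk (j + 2) (by lia))
  have hC' : ∀ i, PowersCommute G i := fun i => hC (2 * s) i (Nat.le_add_left _ _)
  refine ⟨hC', fun x y hx hy => ?_⟩
  obtain ⟨K, hKpow, hKcomm, hK⟩ := hQP.exists_series hG
  have hc := hKcomm 0 0 y (by simpa using hKpow y 0) x (by simpa using hKpow x 0)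
  have hcN : ⁅y, x⁆ ^ 3 ∈ Subgroup.center G :=
    commutator_mem_centralCubeSubgroup (h := hmul) (x := x)
      (by rw [mem_centralCubeSubgroup, hx]; exact one_mem _) y
  obtain ⟨q, z, hz, hq⟩ := hK _ _ hc
  rw [hq, (commute_of_mem_center_left hz _).symm.mul_pow, ← pow_mul, ← pow_succ,
    Subgroup.mul_mem_cancel_right _ (pow_mem hz 3)] at hcN
  have hcomm : ∀ t : G, t ^ 3 = 1 → Commute ⁅y, x⁆ t := by
    intro t ht
    rw [hq]
    refine Commute.mul_left ?_ (commute_of_mem_center_left hz _)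
    simpa using hC' 1 q t hcN (by simp [ht]) 1 0 rfl
  rw [mul_pow_three_of_commute (hcomm y hy) (hcomm x hx) (by rw [hx]; exact Commute.one_left _),
    hx, hy, one_mul]

theorem omega_one_exponent_three (G : Type*) [Group G] [Finite G]
    (hG : IsPGroup 3 G) (hQP : IsQuasiPowerful 3 G) :
    ∀ x ∈ omegaSubgroup G 3, x ^ 3 = 1 := by
  intro x hx
  rw [omegaSubgroup] at hx
  induction hx using Subgroup.closure_induction with
  | mem x hx => exact hx
  | one => exact one_pow 3
  | mul x y _ _ hx hy =>
    exact (quasiPowerful_powersCommute_and_mul_pow_three _ G rfl hG hQP).2 x y hx hy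
  | inv x _ hx => rw [inv_pow, hx, inv_one]
end

section
/- Let p be an odd prime and let G be a quasi-powerful p-group. Then the subgroup H = G^p · Z(G) is strongly powerful; that is, the commutator subgroup [H, H] is contained in the subgroup generated by the p²-th powers of elements of H. -/
open scoped commutatorElement

section Collection

variable {Q : Type*} [Group Q]

/-- The collection formula for `y ^ n * x` when the iterated commutators `d`, `e`, `f` of `x` with
`y` commute with each other and the next one is trivial. -/
theorem pow_mul_eq_of_iterated_comm {x y d e f : Q} (hx : y * x = d * x * y)
    (hd : y * d = e * d * y) (he : y * e = f * e * y) (hf : Commute y f)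
    (hde : Commute d e) (hdf : Commute d f) (hef : Commute e f) (n : ℕ) :
    y ^ n * x = d ^ n * e ^ n.choose 2 * f ^ n.choose 3 * x * y ^ n := by
  have conj_pow {a b c : Q} (h : y * b = c * b * y) (hcb : Commute c b) (m : ℕ) :
      y * b ^ m = c ^ m * b ^ m * y := by
    rw [← hcb.mul_pow]
    exact SemiconjBy.pow_right (a := y) (x := b) (y := c * b) h m
  induction n with
  | zero => simp
  | succ n ih =>
    have h1 := conj_pow (a := 1) hd hde.symm n
    have h2 := conj_pow (a := 1) he hef.symm (n.choose 2)
    have h3 : y * f ^ n.choose 3 = f ^ n.choose 3 * y := (hf.pow_right _).eq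
    have e1 : (n + 1).choose 2 = n + n.choose 2 := by
      rw [Nat.choose_succ_succ' n 1, Nat.choose_one_right]
    have e2 : (n + 1).choose 3 = n.choose 2 + n.choose 3 := Nat.choose_succ_succ' n 2
    have c1 : e ^ n * d ^ n = d ^ n * e ^ n := ((hde.pow_pow n n).eq).symm
    have c2 : f ^ n.choose 2 * e ^ n.choose 2 = e ^ n.choose 2 * f ^ n.choose 2 :=
      ((hef.pow_pow _ _).eq).symm
    have c3 : f ^ n.choose 3 * d = d * f ^ n.choose 3 := ((hdf.pow_right _).eq).symm
    have c4 : f ^ n.choose 2 * d = d * f ^ n.choose 2 := ((hdf.pow_right _).eq).symm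
    have c5 : e ^ n.choose 2 * d = d * e ^ n.choose 2 := ((hde.pow_right _).eq).symm
    have c6 : e ^ n * d = d * e ^ n := ((hde.pow_right _).eq).symm
    calc y ^ (n + 1) * x = y * (y ^ n * x) := by rw [pow_succ', mul_assoc]
      _ = (y * d ^ n) * e ^ n.choose 2 * f ^ n.choose 3 * x * y ^ n := by
        rw [ih]; simp only [mul_assoc]
      _ = e ^ n * d ^ n * (y * e ^ n.choose 2) * f ^ n.choose 3 * x * y ^ n := by
        rw [h1]; simp only [mul_assoc]
      _ = e ^ n * d ^ n * (f ^ n.choose 2 * e ^ n.choose 2) * (y * f ^ n.choose 3) * x * y ^ n := by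
        rw [h2]; simp only [mul_assoc]
      _ = d ^ n * e ^ n * (e ^ n.choose 2 * f ^ n.choose 2) * f ^ n.choose 3 * (y * x) * y ^ n := by
        rw [h3, c1, c2]; simp only [mul_assoc]
      _ = d ^ n * e ^ n * e ^ n.choose 2 * f ^ n.choose 2 * (f ^ n.choose 3 * d) * x *
          (y * y ^ n) := by
        rw [hx]; simp only [mul_assoc]
      _ = d ^ n * e ^ n * e ^ n.choose 2 * (f ^ n.choose 2 * d) * f ^ n.choose 3 * x *
          (y * y ^ n) := by
        rw [c3]; simp only [mul_assoc]
      _ = d ^ n * e ^ n * (e ^ n.choose 2 * d) * f ^ n.choose 2 * f ^ n.choose 3 * x *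
          (y * y ^ n) := by
        rw [c4]; simp only [mul_assoc]
      _ = d ^ n * (e ^ n * d) * e ^ n.choose 2 * f ^ n.choose 2 * f ^ n.choose 3 * x *
          (y * y ^ n) := by
        rw [c5]; simp only [mul_assoc]
      _ = d ^ (n + 1) * e ^ (n + 1).choose 2 * f ^ (n + 1).choose 3 * x * y ^ (n + 1) := by
        rw [c6, e1, e2, pow_add e, pow_add f, pow_succ d, pow_succ' y]; simp only [mul_assoc]

theorem mul_eq_commutatorElement_mul (x y : Q) : y * x = ⁅y, x⁆ * x * y := by
  simp [commutatorElement_def]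

theorem mul_pow_of_mul_eq_mul_of_commute {a b e : Q} (h : b * a = e * a * b) (ha : Commute a e)
    (hb : Commute b e) (n : ℕ) : (a * b) ^ n = a ^ n * b ^ n * e ^ n.choose 2 := by
  induction n with
  | zero => simp
  | succ n ih =>
    have h1 : b * a ^ n = e ^ n * a ^ n * b := by
      rw [← ha.symm.mul_pow]
      exact SemiconjBy.pow_right (a := b) (x := a) (y := e * a) h n
    have e1 : (n + 1).choose 2 = n + n.choose 2 := by
      rw [Nat.choose_succ_succ' n 1, Nat.choose_one_right]
    have c : e ^ n * (a ^ n * b ^ (n + 1)) = a ^ n * b ^ (n + 1) * e ^ n :=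
      ((ha.pow_pow n n).mul_left (hb.pow_pow (n + 1) n)).eq.symm
    calc (a * b) ^ (n + 1) = a * (b * a ^ n) * b ^ n * e ^ n.choose 2 := by
          rw [pow_succ', ih]; simp only [mul_assoc]
      _ = a * (e ^ n * (a ^ n * b ^ (n + 1))) * e ^ n.choose 2 := by
          rw [h1, pow_succ' b]; simp only [mul_assoc]
      _ = a ^ (n + 1) * b ^ (n + 1) * e ^ (n + 1).choose 2 := by
          rw [c, e1, pow_add e, pow_succ' a]; simp only [mul_assoc]

theorem pow_choose_two_eq_one {p : ℕ} (hp : p.Prime) (hodd : Odd p) {e : Q} (he : e ^ p = 1) :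
    e ^ p.choose 2 = 1 := by
  have h2 : 2 < p := lt_of_le_of_ne hp.two_le (by rintro rfl; exact absurd hodd (by decide))
  obtain ⟨k, hk⟩ := hp.dvd_choose_self two_ne_zero h2
  rw [hk, pow_mul, he, one_pow]

/-- `⁅y, x⁆ ^ n = ⁅y ^ n, x⁆` for a central commutator. -/
theorem commutatorElement_pow_left_of_commute {x y : Q} (h : Commute y ⁅y, x⁆) (n : ℕ) :
    ⁅y ^ n, x⁆ = ⁅y, x⁆ ^ n := by
  have key := pow_mul_eq_of_iterated_comm (e := 1) (f := 1) (mul_eq_commutatorElement_mul x y)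
    (by simpa using h.eq) (by simp) (by simp) (by simp) (by simp) (by simp) n
  simp only [one_pow, mul_one] at key
  rw [commutatorElement_def, key]
  group

theorem pow_eq_one_of_mem_closure {p : ℕ} (hp : p.Prime) (hodd : Odd p) {S : Set Q}
    (hS : ∀ s ∈ S, s ^ p = 1)
    (hc : ∀ m ∈ Subgroup.closure S, ∀ g : Q, ⁅m, g⁆ ∈ Subgroup.center Q)
    {m : Q} (hm : m ∈ Subgroup.closure S) : m ^ p = 1 := by
  induction hm using Subgroup.closure_induction with
  | mem x hx => exact hS x hx
  | one => simp
  | inv x _ ih => simp [ih]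
  | mul a b ha hb iha ihb =>
    have hz : ∀ g, Commute g ⁅b, a⁆ := fun g => (Subgroup.mem_center_iff.mp (hc b hb a)) g
    have he : ⁅b, a⁆ ^ p = 1 := by
      rw [← commutatorElement_pow_left_of_commute (hz b), ihb, commutatorElement_one_left]
    rw [mul_pow_of_mul_eq_mul_of_commute (mul_eq_commutatorElement_mul a b) (hz a) (hz b), iha, ihb,
      pow_choose_two_eq_one hp hodd he]
    simp

theorem commutatorElement_pow_eq_one_of_mem_closure {p : ℕ} {S : Set Q}
    (hS : ∀ s ∈ S, s ^ p ∈ Subgroup.center Q)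
    (hc : ∀ m ∈ Subgroup.closure S, ∀ g : Q, ⁅g, m⁆ ∈ Subgroup.center Q)
    {m : Q} (hm : m ∈ Subgroup.closure S) (g : Q) : ⁅g, m⁆ ^ p = 1 := by
  have hz : ∀ m ∈ Subgroup.closure S, ∀ x, Commute x ⁅m, g⁆ := fun m hm x => by
    have := Subgroup.inv_mem _ (hc m hm g)
    rw [commutatorElement_inv] at this
    exact Subgroup.mem_center_iff.mp this x
  rw [← commutatorElement_inv, inv_pow, inv_eq_one]
  induction hm using Subgroup.closure_induction with
  | mem x hx =>
    rw [← commutatorElement_pow_left_of_commute (hz x (Subgroup.subset_closure hx) x),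
      commutatorElement_eq_one_iff_mul_comm, Subgroup.mem_center_iff.mp (hS x hx)]
  | one => simp
  | inv a ha ih =>
    have h := (hz a ha a⁻¹).inv_right
    rw [commutatorElement_inv] at h
    rw [commutatorElement_inv_left, h.eq, inv_mul_cancel_right, ← commutatorElement_inv, inv_pow,
      ih, inv_one]
  | mul a b ha hb iha ihb =>
    rw [commutatorElement_mul_left_eq_conj_mul, (hz b hb a).eq, mul_inv_cancel_right,
      (hz a ha _).mul_pow, iha, ihb, one_mul]

theorem closure_le_center {p : ℕ} (hp : p.Prime) (hodd : Odd p) {S : Set Q}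
    (hS : ∀ s ∈ S, s ^ p = 1)
    (hroot : ∀ s ∈ S, ∃ w, w ^ p = s ∧ ∀ y : Q, ⁅w, y⁆ ∈ Subgroup.closure S)
    (hc : ∀ m ∈ Subgroup.closure S, ∀ g : Q, ⁅m, g⁆ ∈ Subgroup.center Q) :
    Subgroup.closure S ≤ Subgroup.center Q := by
  rw [Subgroup.closure_le]
  intro s hs
  obtain ⟨w, rfl, hw⟩ := hroot s hs
  refine Subgroup.mem_center_iff.mpr fun y => ?_
  have hd := hw y
  have hz : ∀ g, Commute g ⁅w, ⁅w, y⁆⁆ := fun g => by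
    have := Subgroup.inv_mem _ (hc _ hd w)
    rw [commutatorElement_inv] at this
    exact Subgroup.mem_center_iff.mp this g
  have hdp : ⁅w, y⁆ ^ p = 1 := pow_eq_one_of_mem_closure hp hodd hS hc hd
  have hep : ⁅w, ⁅w, y⁆⁆ ^ p = 1 := by
    have h := commutatorElement_pow_left_of_commute (x := ⁅w, y⁆) (hz w) p
    rw [← h, commutatorElement_eq_one_iff_mul_comm]
    have h' := commutatorElement_pow_left_of_commute (x := w) (y := ⁅w, y⁆)
      (Subgroup.mem_center_iff.mp (hc _ hd w) _) p
    rw [hdp, commutatorElement_one_left, ← inv_inj, ← inv_pow, commutatorElement_inv, inv_one] at h'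
    rw [← commutatorElement_eq_one_iff_mul_comm, h, h']
  have key := pow_mul_eq_of_iterated_comm (f := 1) (mul_eq_commutatorElement_mul y w)
    (mul_eq_commutatorElement_mul ⁅w, y⁆ w) (by simpa using (hz w).eq) (by simp)
    (hz _) (by simp) (by simp) p
  rw [hdp, pow_choose_two_eq_one hp hodd hep] at key
  simpa using key.symm

/-- In a group with a chain of subgroups `H`, `K`, `Z` with `Z` central, each containing the
commutators of its predecessor, `p`-th powers commute as soon as the exponents are small. -/
theorem commute_pow_pow {p : ℕ} (hp : p.Prime) (hodd : Odd p) {H K : Subgroup Q}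
    (hH : ∀ x y : Q, ⁅x, y⁆ ∈ H) (hpow : ∀ x : Q, x ^ p ∈ H)
    (hK : ∀ h ∈ H, ∀ y : Q, ⁅y, h⁆ ∈ K)
    (hZ : ∀ k ∈ K, ∀ y : Q, ⁅y, k⁆ ∈ Subgroup.center Q)
    (hHp : ∀ h ∈ H, h ^ p ^ 2 = 1) (hKp : ∀ k ∈ K, ∀ y : Q, ⁅y, k⁆ ^ p = 1)
    (hKH : ∀ k ∈ K, ∀ h ∈ H, Commute h k) (hKleH : K ≤ H) (x y : Q) :
    Commute (x ^ p) (y ^ p) := by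
  have hz : ∀ k ∈ K, ∀ y g : Q, Commute g ⁅y, k⁆ := fun k hk y g =>
    Subgroup.mem_center_iff.mp (hZ k hk y) g
  have h1 : ∀ h ∈ H, ∀ g : Q, ⁅g ^ p, h⁆ = ⁅g, h⁆ ^ p := by
    intro h hh g
    have hc := hK h hh g
    have key := pow_mul_eq_of_iterated_comm (f := 1) (mul_eq_commutatorElement_mul h g)
      (mul_eq_commutatorElement_mul ⁅g, h⁆ g) (by simpa using (hz _ hc g g).eq) (by simp)
      (hz _ hc _ _) (by simp) (by simp) p
    rw [pow_choose_two_eq_one hp hodd (hKp _ hc g)] at key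
    simp only [one_pow, mul_one] at key
    rw [commutatorElement_def, key]
    group
  have h2 : ⁅y ^ p, x⁆ ^ p = 1 := by
    have hd := hH y x
    have he := hK _ hd y
    have key := pow_mul_eq_of_iterated_comm (mul_eq_commutatorElement_mul x y)
      (mul_eq_commutatorElement_mul ⁅y, x⁆ y) (mul_eq_commutatorElement_mul _ y)
      (hz _ he y y) (hKH _ he _ hd) (hz _ he y _) (hz _ he y _) p
    have hc : ⁅y ^ p, x⁆ = ⁅y, x⁆ ^ p * ⁅y, ⁅y, x⁆⁆ ^ p.choose 2 *
        ⁅y, ⁅y, ⁅y, x⁆⁆⁆ ^ p.choose 3 := by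
      rw [commutatorElement_def, key]
      group
    rw [hc, Commute.mul_pow ((hz _ he y _).pow_right _),
      Commute.mul_pow ((hKH _ he _ hd).pow_pow _ _), ← pow_mul, ← pow_mul, ← pow_mul,
      mul_comm (p.choose 2), mul_comm (p.choose 3), ← sq, hHp _ hd, pow_mul _ p, pow_mul _ p,
      hKp _ he y, pow_choose_two_eq_one hp hodd]
    · simp
    · rw [← pow_mul, ← sq, hHp _ (hKleH he)]
  have h3 : ⁅x, y ^ p⁆ ^ p = 1 := by
    rw [← commutatorElement_inv, inv_pow, h2, inv_one]
  rw [← commutatorElement_eq_one_iff_commute, h1 _ (hpow y), h3]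

end Collection

section PowerSubgroups

variable {G : Type*} [Group G]

theorem closure_normal_of_conj_mem {S : Set G} (h : ∀ s ∈ S, ∀ g : G, g * s * g⁻¹ ∈ S) :
    (Subgroup.closure S).Normal := by
  refine ⟨fun n hn g => ?_⟩
  induction hn using Subgroup.closure_induction with
  | mem x hx => exact Subgroup.subset_closure (h x hx g)
  | one => simp
  | inv x _ ih => simpa [mul_assoc] using Subgroup.inv_mem _ ih
  | mul a b _ _ iha ihb => simpa [mul_assoc] using Subgroup.mul_mem _ iha ihb

instance powSubgroup_normal (n : ℕ) : (powSubgroup G n).Normal := by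
  refine closure_normal_of_conj_mem ?_
  rintro _ ⟨x, rfl⟩ g
  exact ⟨g * x * g⁻¹, conj_pow⟩

theorem pow_mem_powSubgroup (n : ℕ) (g : G) : g ^ n ∈ powSubgroup G n :=
  Subgroup.subset_closure ⟨g, rfl⟩

theorem map_powSubgroup {G' : Type*} [Group G'] (f : G →* G') (hf : Function.Surjective f)
    (n : ℕ) : (powSubgroup G n).map f = powSubgroup G' n := by
  rw [powSubgroup, powSubgroup, MonoidHom.map_closure]
  congr 1
  ext x
  constructor
  · rintro ⟨_, ⟨g, rfl⟩, rfl⟩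
    exact ⟨f g, (map_pow f g n).symm⟩
  · rintro ⟨g, rfl⟩
    obtain ⟨a, rfl⟩ := hf g
    exact ⟨a ^ n, ⟨a, rfl⟩, map_pow f a n⟩

theorem powSubgroup_sup_eq_closure (n : ℕ) (Z : Subgroup G) :
    powSubgroup G n ⊔ Z = Subgroup.closure ({x : G | ∃ g : G, g ^ n = x} ∪ Z) := by
  rw [Subgroup.closure_union, Subgroup.closure_eq, powSubgroup]

theorem le_of_le_sup_commutator_top_s17 [Group.IsNilpotent G] {N R : Subgroup G} [R.Normal]
    (h : N ≤ R ⊔ ⁅N, (⊤ : Subgroup G)⁆) : N ≤ R := by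
  have step : ∀ i, N ≤ R ⊔ (⊤ : Subgroup G).lowerCentralSeries i := by
    intro i
    induction i with
    | zero => simp
    | succ i ih =>
      refine h.trans (sup_le le_sup_left ?_)
      refine Subgroup.commutator_le.mpr fun a ha g _ => ?_
      obtain ⟨r, hr, l, hl, rfl⟩ := Subgroup.mem_sup_of_normal_right.mp (ih ha)
      rw [commutatorElement_mul_left_eq_conj_mul]
      refine Subgroup.mul_mem _ ?_ ?_
      · exact (inferInstance : (R ⊔ (⊤ : Subgroup G).lowerCentralSeries (i + 1)).Normal).conj_mem _
          (Subgroup.mem_sup_right (Subgroup.commutator_mem_commutator hl (Subgroup.mem_top g))) r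
      · exact Subgroup.mem_sup_left (Subgroup.commutator_le_left R ⊤
          (Subgroup.commutator_mem_commutator hr (Subgroup.mem_top g)))
  obtain ⟨n, hn⟩ := Subgroup.nilpotent_iff_lowerCentralSeries.mp ‹Group.IsNilpotent G›
  simpa [hn] using step n

theorem commutator_powSubgroup_sup_le [Group.IsNilpotent G] {p : ℕ} (hp : p.Prime) (hodd : Odd p)
    (Z : Subgroup G) [Z.Normal] (hG : commutator G ≤ powSubgroup G p ⊔ Z) (n : ℕ) :
    ⁅powSubgroup G (p ^ n) ⊔ Z, (⊤ : Subgroup G)⁆ ≤ powSubgroup G (p ^ (n + 1)) ⊔ Z := by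
  induction n with
  | zero => simpa using (Subgroup.commutator_mono le_top le_rfl).trans hG
  | succ n ih =>
    refine le_of_le_sup_commutator_top_s17 ?_
    set V := powSubgroup G (p ^ (n + 1)) ⊔ Z
    set R := (powSubgroup G (p ^ (n + 1 + 1)) ⊔ Z) ⊔ ⁅⁅V, (⊤ : Subgroup G)⁆, (⊤ : Subgroup G)⁆
    let f := QuotientGroup.mk' R
    have hf : Function.Surjective f := QuotientGroup.mk'_surjective R
    have hf1 : ∀ {a}, f a = 1 ↔ a ∈ R := fun {a} => QuotientGroup.eq_one_iff a
    have hmap : V.map f = Subgroup.closure (f '' ({x | ∃ g : G, g ^ p ^ (n + 1) = x} ∪ Z)) := by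
      rw [← MonoidHom.map_closure, ← powSubgroup_sup_eq_closure]
    have key : V.map f ≤ Subgroup.center (G ⧸ R) := by
      rw [hmap]
      apply closure_le_center hp hodd
      · rintro _ ⟨_, ⟨g, rfl⟩ | hz, rfl⟩
        · rw [← map_pow, ← pow_mul, ← pow_succ, hf1]
          exact Subgroup.mem_sup_left (Subgroup.mem_sup_left (pow_mem_powSubgroup _ g))
        · rw [hf1.mpr (Subgroup.mem_sup_left (Subgroup.mem_sup_right hz)), one_pow]
      · rintro _ ⟨_, ⟨g, rfl⟩ | hz, rfl⟩
        · refine ⟨f (g ^ p ^ n), by rw [← map_pow, ← pow_mul, ← pow_succ], fun y => ?_⟩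
          obtain ⟨y, rfl⟩ := hf y
          rw [← hmap, ← map_commutatorElement]
          exact Subgroup.mem_map_of_mem f (ih (Subgroup.commutator_mem_commutator
            (Subgroup.mem_sup_left (pow_mem_powSubgroup _ g)) (Subgroup.mem_top y)))
        · refine ⟨1, ?_, fun y => by simp⟩
          rw [one_pow, hf1.mpr (Subgroup.mem_sup_left (Subgroup.mem_sup_right hz))]
      · rw [← hmap]
        rintro _ ⟨v, hv, rfl⟩ g
        obtain ⟨g, rfl⟩ := hf g
        refine Subgroup.mem_center_iff.mpr fun y => ?_
        obtain ⟨y, rfl⟩ := hf y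
        rw [eq_comm, ← map_commutatorElement, ← commutatorElement_eq_one_iff_mul_comm,
          ← map_commutatorElement, hf1]
        exact Subgroup.mem_sup_right (Subgroup.commutator_mem_commutator
          (Subgroup.commutator_mem_commutator hv (Subgroup.mem_top g)) (Subgroup.mem_top y))
    refine Subgroup.commutator_le.mpr fun v hv g _ => ?_
    rw [← hf1, map_commutatorElement, commutatorElement_eq_one_iff_mul_comm]
    exact (Subgroup.mem_center_iff.mp (key (Subgroup.mem_map_of_mem f hv)) (f g)).symm

theorem IsQuasiPowerful.commutator_le {p : ℕ} (h : IsQuasiPowerful p G) :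
    commutator G ≤ powSubgroup G p ⊔ Subgroup.center G := by
  have hf := QuotientGroup.mk'_surjective (Subgroup.center G)
  have h1 : (commutator G).map (QuotientGroup.mk' (Subgroup.center G)) ≤
      (powSubgroup G p).map (QuotientGroup.mk' (Subgroup.center G)) := by
    rw [map_powSubgroup _ hf]
    refine le_trans ?_ h
    rw [commutator_def, commutator_def, Subgroup.map_commutator]
    exact Subgroup.commutator_mono le_top le_top
  rw [Subgroup.map_le_iff_le_comap, Subgroup.comap_map_eq, QuotientGroup.ker_mk'] at h1
  exact h1

end PowerSubgroups

theorem H_strongly_powerful (p : ℕ) (hp : p.Prime) (hodd : Odd p)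
    (G : Type*) [Group G] [Finite G]
    (hG : IsPGroup p G) (hQP : IsQuasiPowerful p G) :
    ⁅powSubgroup G p ⊔ Subgroup.center G, powSubgroup G p ⊔ Subgroup.center G⁆ ≤
      Subgroup.closure {x : G | ∃ h ∈ powSubgroup G p ⊔ Subgroup.center G, h ^ p ^ 2 = x} := by
  have : Fact p.Prime := ⟨hp⟩
  have hnil : Group.IsNilpotent G := hG.isNilpotent
  set Z := Subgroup.center G
  set H := powSubgroup G p ⊔ Z with hHdef
  set K := powSubgroup G (p ^ 2) ⊔ Z
  set N := Subgroup.closure {x : G | ∃ h ∈ H, h ^ p ^ 2 = x}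
  have hcomm := hQP.commutator_le
  have hHK : ⁅H, (⊤ : Subgroup G)⁆ ≤ K := by
    simpa using commutator_powSubgroup_sup_le hp hodd Z hcomm 1
  have hK3 : ⁅K, (⊤ : Subgroup G)⁆ ≤ powSubgroup G (p ^ 3) ⊔ Z := by
    simpa using commutator_powSubgroup_sup_le hp hodd Z hcomm 2
  have hpowH : ∀ x : G, x ^ p ∈ H := fun x => Subgroup.mem_sup_left (pow_mem_powSubgroup p x)
  have hKH : K ≤ H := by
    refine sup_le ?_ le_sup_right
    rw [powSubgroup, Subgroup.closure_le]
    rintro _ ⟨x, rfl⟩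
    rw [sq, pow_mul]
    exact hpowH _
  have h3N : powSubgroup G (p ^ 3) ≤ N := by
    rw [powSubgroup, Subgroup.closure_le]
    rintro _ ⟨x, rfl⟩
    exact Subgroup.subset_closure ⟨x ^ p, hpowH x, by rw [← pow_mul, ← pow_succ']⟩
  have hNnormal : N.Normal := by
    refine closure_normal_of_conj_mem ?_
    rintro _ ⟨h, hh, rfl⟩ g
    exact ⟨g * h * g⁻¹, Subgroup.Normal.conj_mem inferInstance h hh g, conj_pow⟩
  let f := QuotientGroup.mk' N
  have hf : Function.Surjective f := QuotientGroup.mk'_surjective N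
  have hf1 : ∀ {a}, f a = 1 ↔ a ∈ N := fun {a} => QuotientGroup.eq_one_iff a
  have hZc : Z.map f ≤ Subgroup.center (G ⧸ N) := by
    rintro _ ⟨z, hz, rfl⟩
    refine Subgroup.mem_center_iff.mpr fun y => ?_
    obtain ⟨y, rfl⟩ := hf y
    rw [← map_mul, ← map_mul, Subgroup.mem_center_iff.mp hz y]
  have hZK : ∀ k ∈ K.map f, ∀ y : G ⧸ N, ⁅y, k⁆ ∈ Subgroup.center (G ⧸ N) := by
    rintro _ ⟨k, hk, rfl⟩ y
    obtain ⟨y, rfl⟩ := hf y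
    rw [← commutatorElement_inv, ← map_commutatorElement]
    refine Subgroup.inv_mem _ ?_
    obtain ⟨a, ha, z, hz, haz⟩ := Subgroup.mem_sup_of_normal_right.mp
      (hK3 (Subgroup.commutator_mem_commutator hk (Subgroup.mem_top y)))
    rw [← haz, map_mul, hf1.mpr (h3N ha), one_mul]
    exact hZc (Subgroup.mem_map_of_mem f hz)
  have hmapK : K.map f = Subgroup.closure (f '' ({x | ∃ g : G, g ^ p ^ 2 = x} ∪ Z)) := by
    rw [← MonoidHom.map_closure, ← powSubgroup_sup_eq_closure]
  have hHind : ∀ k : G ⧸ N, (∀ y, Commute (y ^ p) k) → ∀ h ∈ H.map f, Commute h k := by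
    intro k hk h hh
    have hle : H.map f ≤ Subgroup.centralizer {k} := by
      rw [Subgroup.map_le_iff_le_comap, hHdef, powSubgroup_sup_eq_closure, Subgroup.closure_le]
      rintro _ (⟨x, rfl⟩ | hz)
      · refine Subgroup.mem_centralizer_singleton_iff.mpr ?_
        rw [map_pow]
        exact (hk (f x)).eq
      · exact Subgroup.mem_centralizer_singleton_iff.mpr
          (Subgroup.mem_center_iff.mp (hZc (Subgroup.mem_map_of_mem f hz)) k).symm
    exact Subgroup.mem_centralizer_singleton_iff.mp (hle hh)
  have hKp : ∀ k ∈ K.map f, ∀ y : G ⧸ N, ⁅y, k⁆ ^ p = 1 := by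
    intro k hk y
    rw [hmapK] at hZK hk
    refine commutatorElement_pow_eq_one_of_mem_closure ?_ hZK hk y
    rintro _ ⟨_, ⟨x, rfl⟩ | hz, rfl⟩
    · rw [← map_pow, ← pow_mul, ← pow_succ, hf1.mpr (h3N (pow_mem_powSubgroup _ x))]
      exact Subgroup.one_mem _
    · exact Subgroup.pow_mem _ (hZc (Subgroup.mem_map_of_mem f hz)) p
  have hKHc : ∀ k ∈ K.map f, ∀ h ∈ H.map f, Commute h k := by
    intro k hk
    refine hHind k (fun y => ?_)
    rw [← commutatorElement_eq_one_iff_commute, commutatorElement_pow_left_of_commute, hKp k hk y]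
    exact Subgroup.mem_center_iff.mp (hZK k hk y) y
  have hcommute := commute_pow_pow (Q := G ⧸ N) hp hodd (H := H.map f) (K := K.map f)
    (fun x y => by
      obtain ⟨x, rfl⟩ := hf x
      obtain ⟨y, rfl⟩ := hf y
      rw [← map_commutatorElement]
      exact Subgroup.mem_map_of_mem f (hcomm
        (Subgroup.commutator_mem_commutator (Subgroup.mem_top x) (Subgroup.mem_top y))))
    (fun x => by
      obtain ⟨x, rfl⟩ := hf x
      rw [← map_pow]
      exact Subgroup.mem_map_of_mem f (hpowH x))
    (by
      rintro _ ⟨h, hh, rfl⟩ y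
      obtain ⟨y, rfl⟩ := hf y
      rw [← map_commutatorElement, ← commutatorElement_inv]
      exact Subgroup.mem_map_of_mem f (Subgroup.inv_mem _
        (hHK (Subgroup.commutator_mem_commutator hh (Subgroup.mem_top y)))))
    hZK
    (by
      rintro _ ⟨h, hh, rfl⟩
      rw [← map_pow, hf1]
      exact Subgroup.subset_closure ⟨h, hh, rfl⟩)
    hKp hKHc (Subgroup.map_mono hKH)
  refine Subgroup.commutator_le.mpr fun a ha b hb => ?_
  rw [← hf1, map_commutatorElement, commutatorElement_eq_one_iff_commute]
  refine hHind _ (fun y => ?_) _ (Subgroup.mem_map_of_mem f ha)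
  exact (hHind _ (fun x => hcommute x y) _ (Subgroup.mem_map_of_mem f hb)).symm
end
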